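/- Let k be an algebraically closed field of characteristic 2 and let G = SO(2n, k) with n ≥ 4. Then the conjugacy class of every involution of G (every element u ≠ 1 with u² = 1) is spherical. -/

import Mathlib

open scoped Matrix

section SphericalDefs

variable (G : Type*) [Group G] [TopologicalSpace G]

/-- A Borel subgroup of an algebraic group: a maximal closed connected solvable subgroup. -/
def IsBorel (B : Subgroup G) : Prop :=
  IsClosed (B : Set G) ∧ IsConnected (B : Set G) ∧ IsSolvable B ∧
    ∀ B' : Subgroup G, IsClosed (B' : Set G) → IsConnected (B' : Set G) → IsSolvable B' →
      B ≤ B' → B' = B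

variable {G}

/-- The orbit of `x` under conjugation by elements of a subgroup `B`. -/
def conjOrbit (B : Subgroup G) (x : G) : Set G := {g | ∃ b ∈ B, g = b * x * b⁻¹}

/-- The conjugacy class of `u`. -/
def conjClass (u : G) : Set G := {v | IsConj u v}

variable (G)

/-- A subset (typically a conjugacy class) of `G` is *spherical* if a Borel subgroup of `G`
has a dense orbit on it (acting by conjugation). -/
def IsSphericalClass (O : Set G) : Prop :=
  ∃ B : Subgroup G, IsBorel G B ∧ ∃ x ∈ O, O ⊆ closure (conjOrbit B x)

/-- A subgroup `H ≤ G` is a *spherical subgroup* if a Borel subgroup of `G` has a dense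
orbit on the homogeneous space `G ⧸ H`, i.e. `G ⧸ H` is a spherical homogeneous space. -/
def IsSphericalSubgroup (H : Subgroup G) : Prop :=
  ∃ B : Subgroup G, IsBorel G B ∧ ∃ x : G ⧸ H, Dense {y : G ⧸ H | ∃ b ∈ B, y = b • x}

end SphericalDefs

/-- The (classical) Zariski topology on the affine space `ι → k`:
a basis of open sets is given by the nonvanishing loci of polynomials. -/
def zariskiTopology (k : Type*) [CommRing k] (ι : Type*) : TopologicalSpace (ι → k) :=
  TopologicalSpace.generateFrom
    {s | ∃ p : MvPolynomial ι k, s = {v | MvPolynomial.eval v p ≠ 0}}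

/-- The Zariski topology on the general linear group `GL m k`, viewing it as an affine
variety via `g ↦ (g, g⁻¹)`. -/
instance glZariskiTopology (m k : Type*) [DecidableEq m] [Fintype m] [CommRing k] :
    TopologicalSpace (GL m k) :=
  TopologicalSpace.induced
    (fun g => Sum.elim (fun p : m × m => ((g : Matrix m m k)) p.1 p.2)
      (fun p : m × m => (((g⁻¹ : GL m k) : Matrix m m k)) p.1 p.2))
    (zariskiTopology k ((m × m) ⊕ (m × m)))

noncomputable section

variable (k : Type*) [Field k] (n : ℕ)

private lemma glInvVec {k : Type*} [Field k] {m : Type*} [DecidableEq m] [Fintype m]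
    (g : GL m k) (u : m → k) :
    (g : Matrix m m k) *ᵥ (((g⁻¹ : GL m k) : Matrix m m k) *ᵥ u) = u := by
  rw [Matrix.mulVec_mulVec, ← Units.val_mul, mul_inv_cancel, Units.val_one,
    Matrix.one_mulVec]

/-- The standard nondegenerate alternating bilinear form on `k^{2n}`. -/
def sympForm (v w : (Fin n ⊕ Fin n) → k) : k :=
  ∑ i : Fin n, (v (Sum.inl i) * w (Sum.inr i) - v (Sum.inr i) * w (Sum.inl i))

/-- The symplectic group `Sp(2n, k)`: the subgroup of `GL(2n, k)` preserving the
standard nondegenerate alternating bilinear form. -/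
def SpGroup : Subgroup (GL (Fin n ⊕ Fin n) k) where
  carrier := {g : GL (Fin n ⊕ Fin n) k | ∀ v w : (Fin n ⊕ Fin n) → k,
      sympForm k n ((g : Matrix (Fin n ⊕ Fin n) (Fin n ⊕ Fin n) k) *ᵥ v)
        ((g : Matrix (Fin n ⊕ Fin n) (Fin n ⊕ Fin n) k) *ᵥ w) = sympForm k n v w}
  mul_mem' := by
    intro a b ha hb v w
    simp only [Units.val_mul, ← Matrix.mulVec_mulVec]
    rw [ha, hb]
  one_mem' := by
    intro v w
    simp [Matrix.one_mulVec]
  inv_mem' := by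
    intro g hg v w
    conv_rhs => rw [← glInvVec g v, ← glInvVec g w, hg]

/-- The standard quadratic form of maximal Witt index on `k^{2n}`. -/
def quadForm (v : (Fin n ⊕ Fin n) → k) : k :=
  ∑ i : Fin n, v (Sum.inl i) * v (Sum.inr i)

/-- The (even) orthogonal group `O(2n, k)`: the subgroup of `GL(2n, k)` preserving the
standard quadratic form of maximal Witt index. -/
def evenOrthGroup : Subgroup (GL (Fin n ⊕ Fin n) k) where
  carrier := {g : GL (Fin n ⊕ Fin n) k | ∀ v : (Fin n ⊕ Fin n) → k,
      quadForm k n ((g : Matrix (Fin n ⊕ Fin n) (Fin n ⊕ Fin n) k) *ᵥ v) = quadForm k n v}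
  mul_mem' := by
    intro a b ha hb v
    simp only [Units.val_mul, ← Matrix.mulVec_mulVec]
    rw [ha, hb]
  one_mem' := by
    intro v
    simp [Matrix.one_mulVec]
  inv_mem' := by
    intro g hg v
    conv_rhs => rw [← glInvVec g v, hg]

/-- The special orthogonal group `SO(2n, k)` in characteristic 2: the connected component
of the identity of `O(2n, k)` in the Zariski topology.  (The connected component of the
identity of a group with translation-continuous topology is a subgroup, so taking
`Subgroup.closure` does not change the underlying set.) -/
def evenSOGroup : Subgroup (GL (Fin n ⊕ Fin n) k) :=
  Subgroup.closure ((↑) '' (connectedComponent (1 : evenOrthGroup k n)))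

/-- A connected Noetherian group whose multiplication is separately continuous is irreducible. -/
theorem irreducibleSpace_of_connectedSpace (G : Type*) [Group G] [TopologicalSpace G]
    [SeparatelyContinuousMul G] [TopologicalSpace.NoetherianSpace G] [ConnectedSpace G] :
    IrreducibleSpace G := by
  have hZ := irreducibleComponent_mem_irreducibleComponents (1 : G)
  set Z := irreducibleComponent (1 : G)
  obtain ⟨o, ho, ⟨a, ha⟩, hoZ⟩ :=
    TopologicalSpace.NoetherianSpace.exists_isOpen_nonempty_subset_irreducibleComponent Z hZ
  have hoi : IsPreirreducible o := hZ.1.isPreirreducible.open_subset ho hoZ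
  have hopen : IsOpen Z := by
    rw [isOpen_iff_forall_mem_open]
    intro z hz
    set φ := Homeomorph.mulLeft (z * a⁻¹)
    have hWo : IsOpen (φ '' o) := φ.isOpenMap _ ho
    have hzW : z ∈ φ '' o := ⟨a, ha, by simp [φ]⟩
    have hWi : IsIrreducible (φ '' o) :=
      ⟨⟨z, hzW⟩, hoi.image _ φ.continuous.continuousOn⟩
    have hsub : Z ⊆ closure (φ '' o) := by
      intro y hy
      rw [mem_closure_iff]
      intro V hV hyV
      obtain ⟨t, -, ht⟩ := hZ.1.isPreirreducible V (φ '' o) hV hWo ⟨y, hy, hyV⟩ ⟨z, hz, hzW⟩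
      exact ⟨t, ht⟩
    exact ⟨φ '' o, subset_closure.trans (hZ.2 hWi.closure hsub), hWo, hzW⟩
  have huniv : Z = Set.univ :=
    IsClopen.eq_univ ⟨isClosed_irreducibleComponent, hopen⟩ ⟨1, mem_irreducibleComponent⟩
  have : IsIrreducible (Set.univ : Set G) := huniv ▸ hZ.1
  exact (irreducibleSpace_def G).2 this

instance Subgroup.separatelyContinuousMul {G : Type*} [Group G] [TopologicalSpace G]
    [SeparatelyContinuousMul G] (H : Subgroup G) : SeparatelyContinuousMul H where
  continuous_const_mul {a} :=
    Continuous.subtype_mk (continuous_const_mul (a : G) |>.comp continuous_subtype_val) _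
  continuous_mul_const {a} :=
    Continuous.subtype_mk (continuous_mul_const (a : G) |>.comp continuous_subtype_val) _

/-- A connected subgroup of a Noetherian group is irreducible as a subset. -/
theorem Subgroup.isIrreducible_of_isConnected {G : Type*} [Group G] [TopologicalSpace G]
    [SeparatelyContinuousMul G] [TopologicalSpace.NoetherianSpace G] {H : Subgroup G}
    (hH : IsConnected (H : Set G)) : IsIrreducible (H : Set G) := by
  have : ConnectedSpace H := isConnected_iff_connectedSpace.1 hH
  have : TopologicalSpace.NoetherianSpace H :=
    Topology.IsInducing.subtypeVal.noetherianSpace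
  have := irreducibleSpace_of_connectedSpace H
  have := (IrreducibleSpace.isIrreducible_univ H).image (Subtype.val : H → G)
    continuous_subtype_val.continuousOn
  simpa using this

/-- In a finite-dimensional Noetherian group every closed connected solvable subgroup is contained
in a Borel subgroup. -/
theorem exists_isBorel_ge {G : Type*} [Group G] [TopologicalSpace G]
    [SeparatelyContinuousMul G] [TopologicalSpace.NoetherianSpace G]
    (hdim : topologicalKrullDim G ≠ ⊤) {S : Subgroup G} (hc : IsClosed (S : Set G))
    (hconn : IsConnected (S : Set G)) (hs : IsSolvable S) :
    ∃ B : Subgroup G, IsBorel G B ∧ S ≤ B := by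
  let irr (H : {H : Subgroup G // IsClosed (H : Set G) ∧ IsConnected (H : Set G)}) :
      TopologicalSpace.IrreducibleCloseds G :=
    ⟨H.1, Subgroup.isIrreducible_of_isConnected H.2.2, H.2.1⟩
  have hmono : ∀ H K, H.1 < K.1 → irr H < irr K := fun H K h => by
    rw [← SetLike.coe_ssubset_coe] at h ⊢
    exact h
  have hfin : FiniteDimensionalOrder (TopologicalSpace.IrreducibleCloseds G) := by
    rw [Order.finiteDimensionalOrder_iff_krullDim_ne_bot_and_top]
    refine ⟨?_, hdim⟩
    have : Nonempty (TopologicalSpace.IrreducibleCloseds G) := ⟨irr ⟨S, hc, hconn⟩⟩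
    exact Order.krullDim_ne_bot_iff.2 this
  have hwf : WellFounded
      (fun a b : TopologicalSpace.IrreducibleCloseds G => b < a) :=
    (SetRel.IsWellFounded.inv_of_finiteDimensional
      {(a, b) : TopologicalSpace.IrreducibleCloseds G × _ | a < b})
  let T : Set {H : Subgroup G // IsClosed (H : Set G) ∧ IsConnected (H : Set G)} :=
    {H | IsSolvable H.1 ∧ S ≤ H.1}
  obtain ⟨B, hB, hmax⟩ := (InvImage.wf irr hwf).has_min T ⟨⟨S, hc, hconn⟩, hs, le_rfl⟩
  refine ⟨B.1, ⟨B.2.1, B.2.2, hB.1, fun B' h1 h2 h3 h4 => ?_⟩, hB.2⟩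
  by_contra hne
  exact hmax ⟨B', h1, h2⟩ ⟨h3, hB.2.trans h4⟩ (hmono _ _ (lt_of_le_of_ne h4 (Ne.symm hne)))

/-- The connected component of the identity as a subgroup. -/
def connectedComponentSubgroup (G : Type*) [Group G] [TopologicalSpace G]
    [SeparatelyContinuousMul G] [ContinuousInv G] : Subgroup G where
  carrier := connectedComponent 1
  one_mem' := mem_connectedComponent
  mul_mem' {a b} ha hb := by
    have h := (continuous_const_mul a).image_connectedComponent_subset (1 : G) ⟨b, hb, rfl⟩
    rw [mul_one] at h
    rwa [connectedComponent_eq ha]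
  inv_mem' {a} ha := by
    have h := (continuous_const_mul a⁻¹).image_connectedComponent_subset (1 : G)
      ⟨1, mem_connectedComponent, rfl⟩
    have h' := (continuous_const_mul a⁻¹).image_connectedComponent_subset (1 : G)
      ⟨a, ha, rfl⟩
    simp only [mul_one, inv_mul_cancel] at h h'
    rw [← connectedComponent_eq h']
    exact mem_connectedComponent

section ZariskiGL

variable {F : Type*} [Field F] {m : Type*} [DecidableEq m] [Fintype m]

/-- The coordinates of a point of the general linear group as an affine variety. -/
def glCoords (g : GL m F) : (m × m) ⊕ (m × m) → F :=
  Sum.elim (fun p => (g : Matrix m m F) p.1 p.2) (fun p => ((g⁻¹ : GL m F) : Matrix m m F) p.1 p.2)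

/-- The point of the prime spectrum of the coordinate ring defined by an invertible matrix. -/
def glSpecPoint (g : GL m F) : PrimeSpectrum (MvPolynomial ((m × m) ⊕ (m × m)) F) :=
  PrimeSpectrum.comap (MvPolynomial.eval (glCoords g)) ⊥

theorem isInducing_glSpecPoint :
    Topology.IsInducing (glSpecPoint : GL m F → PrimeSpectrum _) := by
  constructor
  have h : (PrimeSpectrum.zariskiTopology :
      TopologicalSpace (PrimeSpectrum (MvPolynomial ((m × m) ⊕ (m × m)) F))) = _ :=
    PrimeSpectrum.isTopologicalBasis_basic_opens.eq_generateFrom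
  rw [h, induced_generateFrom_eq]
  change TopologicalSpace.induced glCoords (TopologicalSpace.generateFrom _) = _
  rw [induced_generateFrom_eq]
  congr 1
  ext s
  constructor
  · rintro ⟨_, ⟨p, rfl⟩, rfl⟩
    exact ⟨_, ⟨p, rfl⟩, rfl⟩
  · rintro ⟨_, ⟨p, rfl⟩, rfl⟩
    exact ⟨_, ⟨p, rfl⟩, rfl⟩

instance glNoetherianSpace : TopologicalSpace.NoetherianSpace (GL m F) :=
  isInducing_glSpecPoint.noetherianSpace

theorem topologicalKrullDim_gl_subgroup_ne_top (H : Subgroup (GL m F)) :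
    topologicalKrullDim H ≠ ⊤ := by
  have h1 := topologicalKrullDim_subspace_le (GL m F) (H : Set (GL m F))
  have h2 := (isInducing_glSpecPoint (F := F) (m := m)).topologicalKrullDim_le
  rw [PrimeSpectrum.topologicalKrullDim_eq_ringKrullDim,
    MvPolynomial.ringKrullDim_of_isNoetherianRing, ringKrullDim_eq_zero_of_field, zero_add] at h2
  refine ne_top_of_le_ne_top ?_ (h1.trans h2)
  exact (WithBot.coe_lt_coe.2 (ENat.natCast_lt_top _)).ne

/-- The algebra of regular functions on the general linear group. -/
def glRegular (F m : Type*) [Field F] [DecidableEq m] [Fintype m] :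
    Subalgebra F (GL m F → F) :=
  (MvPolynomial.aeval (fun i (g : GL m F) => glCoords g i)).range

theorem aeval_pi_apply {X σ : Type*} (c : σ → X → F) (p : MvPolynomial σ F) (x : X) :
    MvPolynomial.aeval c p x = MvPolynomial.eval (fun i => c i x) p := by
  have := MvPolynomial.map_aeval c (Pi.evalRingHom (fun _ : X => F) x) p
  simp only [Pi.evalRingHom_apply] at this
  rw [this]
  rfl

theorem isOpen_ne_zero_of_mem_glRegular {φ : GL m F → F} (hφ : φ ∈ glRegular F m) :
    IsOpen {g | φ g ≠ 0} := by
  obtain ⟨p, rfl⟩ := hφ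
  refine ⟨{v | MvPolynomial.eval v p ≠ 0}, .basic _ ⟨p, rfl⟩, ?_⟩
  ext g
  change _ ↔ MvPolynomial.aeval (fun i (g : GL m F) => glCoords g i) p g ≠ 0
  rw [aeval_pi_apply]
  rfl

theorem entry_mem_glRegular (i j : m) :
    (fun g : GL m F => (g : Matrix m m F) i j) ∈ glRegular F m :=
  ⟨MvPolynomial.X (Sum.inl (i, j)), by simp [glCoords]⟩

theorem inv_entry_mem_glRegular (i j : m) :
    (fun g : GL m F => ((g⁻¹ : GL m F) : Matrix m m F) i j) ∈ glRegular F m :=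
  ⟨MvPolynomial.X (Sum.inr (i, j)), by simp [glCoords]⟩

/-- A map to the general linear group with regular coordinates is continuous. -/
theorem continuous_gl_of_entries {X : Type*} [TopologicalSpace X] (A : Subalgebra F (X → F))
    (hA : ∀ φ ∈ A, IsOpen {x | φ x ≠ 0}) {f : X → GL m F}
    (h1 : ∀ i j, (fun x => (f x : Matrix m m F) i j) ∈ A)
    (h2 : ∀ i j, (fun x => (((f x)⁻¹ : GL m F) : Matrix m m F) i j) ∈ A) : Continuous f := by
  rw [continuous_induced_rng]
  refine continuous_generateFrom_iff.2 ?_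
  rintro _ ⟨p, rfl⟩
  have hmem : MvPolynomial.aeval (fun i x => glCoords (f x) i) p ∈ A := by
    have hc : ∀ i, (fun x => glCoords (f x) i) ∈ A := by
      rintro (⟨i, j⟩ | ⟨i, j⟩)
      exacts [h1 i j, h2 i j]
    induction p using MvPolynomial.induction_on with
    | C a => simp
    | add p q hp hq => simpa using A.add_mem hp hq
    | mul_X p i hp => simpa using A.mul_mem hp (hc i)
  have := hA _ hmem
  simp only [aeval_pi_apply] at this
  exact this

instance glSeparatelyContinuousMul : SeparatelyContinuousMul (GL m F) where
  continuous_const_mul {a} := by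
    refine continuous_gl_of_entries (glRegular F m)
      (fun _ => isOpen_ne_zero_of_mem_glRegular) (fun i j => ?_) (fun i j => ?_)
    · simp only [Units.val_mul, Matrix.mul_apply]
      have := Subalgebra.sum_mem (glRegular F m) (t := Finset.univ)
        (f := fun l (g : GL m F) => (a : Matrix m m F) i l * (g : Matrix m m F) l j)
        fun l _ => Subalgebra.smul_mem _ (entry_mem_glRegular l j) _
      convert this
      simp
    · simp only [mul_inv_rev, Units.val_mul, Matrix.mul_apply]
      have := Subalgebra.sum_mem (glRegular F m) (t := Finset.univ)
        (f := fun l (g : GL m F) => ((a⁻¹ : GL m F) : Matrix m m F) l j *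
          ((g⁻¹ : GL m F) : Matrix m m F) i l)
        fun l _ => Subalgebra.smul_mem _ (inv_entry_mem_glRegular i l) _
      convert this
      simp [mul_comm]
  continuous_mul_const {a} := by
    refine continuous_gl_of_entries (glRegular F m)
      (fun _ => isOpen_ne_zero_of_mem_glRegular) (fun i j => ?_) (fun i j => ?_)
    · simp only [Units.val_mul, Matrix.mul_apply]
      have := Subalgebra.sum_mem (glRegular F m) (t := Finset.univ)
        (f := fun l (g : GL m F) => (a : Matrix m m F) l j * (g : Matrix m m F) i l)
        fun l _ => Subalgebra.smul_mem _ (entry_mem_glRegular i l) _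
      convert this
      simp [mul_comm]
    · simp only [mul_inv_rev, Units.val_mul, Matrix.mul_apply]
      have := Subalgebra.sum_mem (glRegular F m) (t := Finset.univ)
        (f := fun l (g : GL m F) => ((a⁻¹ : GL m F) : Matrix m m F) i l *
          ((g⁻¹ : GL m F) : Matrix m m F) l j)
        fun l _ => Subalgebra.smul_mem _ (inv_entry_mem_glRegular l j) _
      convert this
      simp

instance glContinuousInv : ContinuousInv (GL m F) where
  continuous_inv := continuous_gl_of_entries (glRegular F m)
    (fun _ => isOpen_ne_zero_of_mem_glRegular) inv_entry_mem_glRegular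
    (fun i j => by simpa using entry_mem_glRegular i j)

/-- The algebra of functions on a principal open subset of the line that become polynomial after
multiplication by a power of the defining polynomial. -/
def lineRegular (q : Polynomial F) : Subalgebra F ({t : F // q.eval t ≠ 0} → F) where
  carrier := {φ | ∃ (N : ℕ) (a : Polynomial F), ∀ t, φ t * q.eval t.1 ^ N = a.eval t.1}
  mul_mem' := by
    rintro φ ψ ⟨N, a, ha⟩ ⟨M, b, hb⟩
    refine ⟨N + M, a * b, fun t => ?_⟩
    rw [Polynomial.eval_mul, ← ha, ← hb, Pi.mul_apply]
    ring
  add_mem' := by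
    rintro φ ψ ⟨N, a, ha⟩ ⟨M, b, hb⟩
    refine ⟨N + M, a * q ^ M + b * q ^ N, fun t => ?_⟩
    rw [Polynomial.eval_add, Polynomial.eval_mul, Polynomial.eval_mul, ← ha, ← hb, Pi.add_apply,
      Polynomial.eval_pow, Polynomial.eval_pow]
    ring
  algebraMap_mem' c := ⟨0, Polynomial.C c, fun t => by simp⟩

/-- The image of a principal open subset of the line under a morphism is preconnected. -/
theorem isPreconnected_range_of_lineRegular [Infinite F] (q : Polynomial F)
    {f : {t : F // q.eval t ≠ 0} → GL m F}
    (h1 : ∀ i j, (fun t => (f t : Matrix m m F) i j) ∈ lineRegular q)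
    (h2 : ∀ i j, (fun t => (((f t)⁻¹ : GL m F) : Matrix m m F) i j) ∈ lineRegular q) :
    IsPreconnected (Set.range f) := by
  by_cases hq : q = 0
  · subst hq
    have : IsEmpty {t : F // (0 : Polynomial F).eval t ≠ 0} := ⟨fun t => t.2 (by simp)⟩
    rw [Set.range_eq_empty]
    exact isPreconnected_empty
  have hroots : ∀ a : Polynomial F, a ≠ 0 → {t : F | a.eval t = 0}.Finite := fun a ha =>
    (Polynomial.finite_setOfPred_isRoot ha)
  have hinf : Infinite {t : F // q.eval t ≠ 0} :=
    (Set.Finite.infinite_compl (hroots q hq)).to_subtype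
  let τ : TopologicalSpace {t : F // q.eval t ≠ 0} := TopologicalSpace.cofinite
  have hτ : ∀ s : Set {t : F // q.eval t ≠ 0}, IsOpen s ↔ (s.Nonempty → sᶜ.Finite) :=
    fun s => Iff.rfl
  have hcont : Continuous f := by
    refine continuous_gl_of_entries (lineRegular q) ?_ h1 h2
    rintro φ ⟨N, a, ha⟩
    rw [hτ]
    rintro ⟨t, ht⟩
    have ha0 : a ≠ 0 := by
      rintro rfl
      have := ha t
      rw [Polynomial.eval_zero, mul_eq_zero] at this
      exact this.elim ht (pow_ne_zero _ t.2)
    refine ((hroots a ha0).preimage Subtype.val_injective.injOn).subset fun s hs => ?_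
    have hs' : φ s = 0 := by simpa using hs
    change a.eval s.1 = 0
    rw [← ha, hs', zero_mul]
  rw [← Set.image_univ]
  refine IsPreconnected.image (IsPreirreducible.isPreconnected ?_) f hcont.continuousOn
  rintro U V hU hV ⟨x, -, hx⟩ ⟨y, -, hy⟩
  have hf := ((hτ U).1 hU ⟨x, hx⟩).union ((hτ V).1 hV ⟨y, hy⟩)
  obtain ⟨z, hz⟩ := hf.infinite_compl.nonempty
  exact ⟨z, trivial, by simpa using hz⟩

end ZariskiGL

section Triangular

open scoped commutatorElement

variable {F : Type*} [Field F] {m : Type*} [DecidableEq m] [Fintype m]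

/-- The matrices raising the weight of the index by at least `j`. -/
def weightFiltration (F : Type*) [Field F] {m : Type*} (w : m → ℕ) (j : ℕ) :
    Submodule F (Matrix m m F) where
  carrier := {x | ∀ a b, w b < w a + j → x a b = 0}
  add_mem' hx hy a b h := by simp [hx a b h, hy a b h]
  zero_mem' := by simp
  smul_mem' c x hx a b h := by simp [hx a b h]

theorem mul_mem_weightFiltration {m : Type*} [Fintype m] {w : m → ℕ} {i j : ℕ}
    {x y : Matrix m m F}
    (hx : x ∈ weightFiltration F w i) (hy : y ∈ weightFiltration F w j) :
    x * y ∈ weightFiltration F w (i + j) := by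
  intro a b h
  rw [Matrix.mul_apply]
  refine Finset.sum_eq_zero fun c _ => ?_
  by_cases hc : w c < w a + i
  · rw [hx a c hc, zero_mul]
  · rw [hy c b (by omega), mul_zero]

theorem weightFiltration_anti {m : Type*} {w : m → ℕ} {i j : ℕ} (h : i ≤ j) :
    weightFiltration F w j ≤ weightFiltration F w i :=
  fun _ hx a b hab => hx a b (by omega)

theorem one_mem_weightFiltration {m : Type*} [DecidableEq m] (w : m → ℕ) :
    (1 : Matrix m m F) ∈ weightFiltration F w 0 := by
  intro a b h
  exact Matrix.one_apply_ne (by rintro rfl; omega)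

theorem commutator_mem_weightFiltration {m : Type*} [Fintype m] {w : m → ℕ}
    (hw : Function.Injective w) {j : ℕ} {x y : Matrix m m F}
    (hx : x ∈ weightFiltration F w j) (hy : y ∈ weightFiltration F w j) :
    x * y - y * x ∈ weightFiltration F w (j + 1) := by
  rcases Nat.eq_zero_or_pos j with rfl | hj
  · intro a b h
    by_cases hab : w b < w a
    · have h1 := mul_mem_weightFiltration hx hy a b (by omega)
      have h2 := mul_mem_weightFiltration hy hx a b (by omega)
      simp [h1, h2]
    · obtain rfl : a = b := hw (by omega)
      have key : ∀ {x y : Matrix m m F}, x ∈ weightFiltration F w 0 →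
          y ∈ weightFiltration F w 0 → (x * y) a a = x a a * y a a := by
        intro x y hx hy
        rw [Matrix.mul_apply]
        refine Finset.sum_eq_single a (fun c _ hc => ?_) (by simp)
        rcases lt_or_gt_of_ne (fun h => hc (hw h)) with h | h
        · rw [hx a c (by omega), zero_mul]
        · rw [hy c a (by omega), mul_zero]
      rw [Matrix.sub_apply, key hx hy, key hy hx, mul_comm, sub_self]
  · exact weightFiltration_anti (by omega : j + 1 ≤ j + j)
      (Submodule.sub_mem _ (mul_mem_weightFiltration hx hy) (mul_mem_weightFiltration hy hx))

/-- The group of invertible matrices which differ from the identity by matrices raising the weight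
by at least `j`; for `j = 0` it consists of triangular matrices. -/
def weightGroup (F : Type*) [Field F] {m : Type*} [DecidableEq m] [Fintype m]
    (w : m → ℕ) (j : ℕ) : Subgroup (GL m F) where
  carrier := {g | (g : Matrix m m F) - 1 ∈ weightFiltration F w j ∧
    ((g⁻¹ : GL m F) : Matrix m m F) - 1 ∈ weightFiltration F w j}
  mul_mem' := by
    have key : ∀ {x y : Matrix m m F}, x - 1 ∈ weightFiltration F w j →
        y - 1 ∈ weightFiltration F w j → x * y - 1 ∈ weightFiltration F w j := by
      intro x y hx hy
      have : x * y - 1 = (x - 1) * (y - 1) + (x - 1) + (y - 1) := by noncomm_ring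
      rw [this]
      exact add_mem (add_mem (weightFiltration_anti (by omega)
        (mul_mem_weightFiltration hx hy)) hx) hy
    rintro g h ⟨hg, hg'⟩ ⟨hh, hh'⟩
    refine ⟨by simpa using key hg hh, ?_⟩
    rw [mul_inv_rev]
    exact key hh' hg'
  one_mem' := by simp
  inv_mem' := by
    rintro g ⟨hg, hg'⟩
    exact ⟨hg', by simpa using hg⟩

theorem commutator_weightGroup_le {w : m → ℕ} (hw : Function.Injective w) (j : ℕ) :
    ⁅weightGroup F w j, weightGroup F w j⁆ ≤ weightGroup F w (j + 1) := by
  rw [Subgroup.commutator_le]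
  have key : ∀ g ∈ weightGroup F w j, ∀ h ∈ weightGroup F w j,
      ((⁅g, h⁆ : GL m F) : Matrix m m F) - 1 ∈ weightFiltration F w (j + 1) := by
    intro g hg h hh
    have hmem : ∀ g ∈ weightGroup F w j,
        ((g⁻¹ : GL m F) : Matrix m m F) ∈ weightFiltration F w 0 := fun g hg => by
      have := add_mem (weightFiltration_anti (Nat.zero_le j) hg.2) (one_mem_weightFiltration w)
      simpa using this
    have h1 := mul_mem_weightFiltration (commutator_mem_weightFiltration hw hg.1 hh.1)
      (mul_mem_weightFiltration (hmem g hg) (hmem h hh))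
    have h2 : ((⁅g, h⁆ : GL m F) : Matrix m m F) - 1 =
        (((g : Matrix m m F) - 1) * ((h : Matrix m m F) - 1) -
          ((h : Matrix m m F) - 1) * ((g : Matrix m m F) - 1)) *
        (((g⁻¹ : GL m F) : Matrix m m F) * ((h⁻¹ : GL m F) : Matrix m m F)) := by
      have h3 : (((g : Matrix m m F) - 1) * ((h : Matrix m m F) - 1) -
          ((h : Matrix m m F) - 1) * ((g : Matrix m m F) - 1)) =
          (g * h : Matrix m m F) - h * g := by noncomm_ring
      have h4 : (h * g : Matrix m m F) *
          (((g⁻¹ : GL m F) : Matrix m m F) * ((h⁻¹ : GL m F) : Matrix m m F)) = 1 := by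
        rw [← Units.val_mul, ← Units.val_mul, ← Units.val_mul]
        simp
      rw [h3, sub_mul, h4, commutatorElement_def]
      simp [mul_assoc]
    rw [h2]
    simpa using h1
  intro g hg h hh
  refine ⟨key g hg h hh, ?_⟩
  rw [commutatorElement_inv]
  exact key h hh g hg

theorem weightGroup_eq_bot {w : m → ℕ} {N : ℕ} (hN : ∀ a, w a < N) :
    weightGroup F w N = ⊥ := by
  rw [eq_bot_iff]
  intro g hg
  rw [Subgroup.mem_bot]
  ext a b
  have := hg.1 a b (by have := hN b; omega)
  rw [Matrix.sub_apply, sub_eq_zero] at this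
  rw [this, Units.val_one]

theorem isSolvable_of_commutator_chain {G : Type*} [Group G] (H : ℕ → Subgroup G)
    (hH : ∀ j, ⁅H j, H j⁆ ≤ H (j + 1)) {N : ℕ} (hN : H N = ⊥) : Group.IsSolvable (H 0) := by
  have key : ∀ j, (derivedSeries (H 0) j).map (H 0).subtype ≤ H j := by
    intro j
    induction j with
    | zero => rintro _ ⟨x, -, rfl⟩; exact x.2
    | succ j ih =>
      rw [derivedSeries_succ, Subgroup.map_commutator]
      exact (Subgroup.commutator_mono ih ih).trans (hH j)
  refine ⟨N, ?_⟩
  have := key N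
  rw [hN, le_bot_iff, Subgroup.map_eq_bot_iff_of_injective _ (Subgroup.subtype_injective _)] at this
  exact this

theorem isSolvable_weightGroup {w : m → ℕ} (hw : Function.Injective w) :
    Group.IsSolvable (weightGroup F w 0) :=
  isSolvable_of_commutator_chain (weightGroup F w) (commutator_weightGroup_le hw)
    (weightGroup_eq_bot (N := Finset.univ.sup w + 1) fun a =>
      Nat.lt_succ_of_le (Finset.le_sup (Finset.mem_univ a)))

theorem isClosed_eq_zero_of_mem_glRegular {φ : GL m F → F} (hφ : φ ∈ glRegular F m) :
    IsClosed {g | φ g = 0} := by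
  rw [← isOpen_compl_iff]
  exact isOpen_ne_zero_of_mem_glRegular hφ

theorem isClosed_weightGroup (w : m → ℕ) (j : ℕ) :
    IsClosed (weightGroup F w j : Set (GL m F)) := by
  have : (weightGroup F w j : Set (GL m F)) = ⋂ (a : m) (b : m) (_ : w b < w a + j),
      ({g : GL m F | (g : Matrix m m F) a b - (1 : Matrix m m F) a b = 0} ∩
      {g : GL m F | ((g⁻¹ : GL m F) : Matrix m m F) a b - (1 : Matrix m m F) a b = 0}) := by
    ext g
    simp only [Set.mem_iInter]
    exact ⟨fun h a b hab => ⟨h.1 a b hab, h.2 a b hab⟩,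
      fun h => ⟨fun a b hab => (h a b hab).1, fun a b hab => (h a b hab).2⟩⟩
  rw [this]
  refine isClosed_iInter fun a => isClosed_iInter fun b => isClosed_iInter fun _ => ?_
  exact (isClosed_eq_zero_of_mem_glRegular
    (sub_mem (entry_mem_glRegular a b) ((glRegular F m).algebraMap_mem _))).inter
    (isClosed_eq_zero_of_mem_glRegular
      (sub_mem (inv_entry_mem_glRegular a b) ((glRegular F m).algebraMap_mem _)))

end Triangular

section Siegel

variable {F : Type*} [Field F] {n : ℕ}

theorem mem_evenOrthGroup_iff {g : GL (Fin n ⊕ Fin n) F} :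
    g ∈ evenOrthGroup F n ↔ ∀ v, quadForm F n ((g : Matrix _ _ F) *ᵥ v) = quadForm F n v := Iff.rfl

theorem quadForm_sumElim (x y : Fin n → F) : quadForm F n (Sum.elim x y) = x ⬝ᵥ y := rfl

/-- The element of the Siegel parabolic subgroup with Levi component given by the matrix `A` and
unipotent component given by the matrix `X`. -/
def siegelElt (A A' X : Matrix (Fin n) (Fin n) F) (h : A * A' = 1) (h' : A' * A = 1) :
    GL (Fin n ⊕ Fin n) F where
  val := Matrix.fromBlocks A (A * X) 0 A'ᵀ
  inv := Matrix.fromBlocks A' (-(X * Aᵀ)) 0 Aᵀ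
  val_inv := by
    have e : A'ᵀ * Aᵀ = 1 := by rw [← Matrix.transpose_mul, h, Matrix.transpose_one]
    rw [Matrix.fromBlocks_multiply, e, h]
    simp [Matrix.mul_assoc]
  inv_val := by
    have e : Aᵀ * A'ᵀ = 1 := by rw [← Matrix.transpose_mul, h', Matrix.transpose_one]
    rw [Matrix.fromBlocks_multiply, ← Matrix.mul_assoc A', h', Matrix.neg_mul (X * Aᵀ) A'ᵀ,
      Matrix.mul_assoc X Aᵀ A'ᵀ, e]
    simp

theorem coe_siegelElt {A A' X : Matrix (Fin n) (Fin n) F} (h : A * A' = 1) (h' : A' * A = 1) :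
    (siegelElt A A' X h h' : Matrix _ _ F) = Matrix.fromBlocks A (A * X) 0 A'ᵀ := rfl

theorem coe_inv_siegelElt {A A' X : Matrix (Fin n) (Fin n) F} (h : A * A' = 1) (h' : A' * A = 1) :
    (((siegelElt A A' X h h')⁻¹ : GL _ F) : Matrix _ _ F) =
      Matrix.fromBlocks A' (-(X * Aᵀ)) 0 Aᵀ := rfl

theorem mulVec_dotProduct_mulVec_transpose {A A' : Matrix (Fin n) (Fin n) F} (h' : A' * A = 1)
    (x y : Fin n → F) : (A *ᵥ x) ⬝ᵥ (A'ᵀ *ᵥ y) = x ⬝ᵥ y := by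
  rw [Matrix.dotProduct_mulVec, Matrix.vecMul_transpose, Matrix.mulVec_mulVec, h',
    Matrix.one_mulVec]

theorem siegelElt_mem_evenOrthGroup {A A' X : Matrix (Fin n) (Fin n) F} (h : A * A' = 1)
    (h' : A' * A = 1) (hX : ∀ y, (X *ᵥ y) ⬝ᵥ y = 0) :
    siegelElt A A' X h h' ∈ evenOrthGroup F n := by
  rw [mem_evenOrthGroup_iff]
  intro v
  obtain ⟨x, y, rfl⟩ : ∃ x y, v = Sum.elim x y := ⟨_, _, (Sum.elim_comp_inl_inr v).symm⟩
  rw [coe_siegelElt, Matrix.fromBlocks_mulVec, quadForm_sumElim, quadForm_sumElim]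
  simp only [Sum.elim_comp_inl, Sum.elim_comp_inr, Matrix.zero_mulVec, zero_add]
  rw [← Matrix.mulVec_mulVec, ← Matrix.mulVec_add, mulVec_dotProduct_mulVec_transpose h',
    add_dotProduct, hX, add_zero]

/-- The weights of the coordinates defining the standard Borel subgroup. -/
def stdWeight (n : ℕ) : Fin n ⊕ Fin n → ℕ := Sum.elim (fun i => i) (fun i => 2 * n - i)

theorem stdWeight_injective : Function.Injective (stdWeight n) := by
  rintro (i | i) (j | j) h <;> simp only [stdWeight, Sum.elim_inl, Sum.elim_inr] at h
  · exact congrArg _ (Fin.ext h)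
  · omega
  · omega
  · exact congrArg _ (Fin.ext (by omega))

/-- The standard triangular subgroup of the orthogonal group. -/
def stdTriangular (F : Type*) [Field F] (n : ℕ) : Subgroup (GL (Fin n ⊕ Fin n) F) :=
  weightGroup F (stdWeight n) 0 ⊓ evenOrthGroup F n

theorem mem_weightGroup_zero {m : Type*} [DecidableEq m] [Fintype m] {w : m → ℕ} {g : GL m F} :
    g ∈ weightGroup F w 0 ↔ (∀ a b, w b < w a → (g : Matrix m m F) a b = 0) ∧
      ∀ a b, w b < w a → ((g⁻¹ : GL m F) : Matrix m m F) a b = 0 := by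
  have key : ∀ x : Matrix m m F, x - 1 ∈ weightFiltration F w 0 ↔
      ∀ a b, w b < w a → x a b = 0 := by
    intro x
    refine ⟨fun h a b hab => ?_, fun h => sub_mem h (one_mem_weightFiltration w)⟩
    have := add_mem h (one_mem_weightFiltration w)
    rw [sub_add_cancel] at this
    exact this a b hab
  exact and_congr (key _) (key _)

theorem siegelElt_mem_weightGroup {A A' X : Matrix (Fin n) (Fin n) F} (h : A * A' = 1)
    (h' : A' * A = 1) (hA : A.BlockTriangular id) (hA' : A'.BlockTriangular id) :
    siegelElt A A' X h h' ∈ weightGroup F (stdWeight n) 0 := by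
  rw [mem_weightGroup_zero, coe_siegelElt, coe_inv_siegelElt]
  constructor <;> rintro (i | i) (j | j) hij <;>
    simp only [stdWeight, Sum.elim_inl, Sum.elim_inr] at hij
  · exact hA (by simpa using hij)
  · omega
  · rfl
  · exact hA' (show i < j by omega)
  · exact hA' (by simpa using hij)
  · omega
  · rfl
  · exact hA (show i < j by omega)

theorem siegelElt_mem_stdTriangular {A A' X : Matrix (Fin n) (Fin n) F} (h : A * A' = 1)
    (h' : A' * A = 1) (hA : A.BlockTriangular id) (hX : ∀ y, (X *ᵥ y) ⬝ᵥ y = 0) :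
    siegelElt A A' X h h' ∈ stdTriangular F n := by
  refine ⟨siegelElt_mem_weightGroup h h' hA ?_, siegelElt_mem_evenOrthGroup h h' hX⟩
  have : Invertible A := ⟨A', h', h⟩
  have h3 := Matrix.blockTriangular_inv_of_blockTriangular hA
  rwa [Matrix.inv_eq_right_inv h] at h3

theorem exists_eq_siegelElt_of_toBlocks {g : GL (Fin n ⊕ Fin n) F} (hg : g ∈ evenOrthGroup F n)
    (h0 : (g : Matrix (Fin n ⊕ Fin n) (Fin n ⊕ Fin n) F).toBlocks₂₁ = 0) :
    ∃ (A A' X : Matrix (Fin n) (Fin n) F) (h : A * A' = 1) (h' : A' * A = 1),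
      A = (g : Matrix (Fin n ⊕ Fin n) (Fin n ⊕ Fin n) F).toBlocks₁₁ ∧
        (∀ y, (X *ᵥ y) ⬝ᵥ y = 0) ∧ g = siegelElt A A' X h h' := by
  set G : Matrix (Fin n ⊕ Fin n) (Fin n ⊕ Fin n) F := g.val with hG
  have e1 : G = Matrix.fromBlocks G.toBlocks₁₁ G.toBlocks₁₂ 0 G.toBlocks₂₂ := by
    conv_lhs => rw [← Matrix.fromBlocks_toBlocks G, h0]
  set A := G.toBlocks₁₁
  set B := G.toBlocks₁₂
  set D := G.toBlocks₂₂
  have hq : ∀ x y, (A *ᵥ x + B *ᵥ y) ⬝ᵥ (D *ᵥ y) = x ⬝ᵥ y := by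
    intro x y
    have := hg (Sum.elim x y)
    rw [← hG, e1, Matrix.fromBlocks_mulVec, quadForm_sumElim, quadForm_sumElim] at this
    simpa using this
  have hB : ∀ y, (B *ᵥ y) ⬝ᵥ (D *ᵥ y) = 0 := fun y => by simpa using hq 0 y
  have h5 : Aᵀ * D = 1 := by
    rw [Matrix.ext_iff_mulVec]
    intro y
    refine dotProduct_eq _ _ fun x => ?_
    rw [dotProduct_comm _ x, dotProduct_comm _ x, Matrix.one_mulVec, ← hq x y, add_dotProduct, hB,
      add_zero, ← Matrix.mulVec_mulVec, Matrix.dotProduct_mulVec, Matrix.vecMul_transpose]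
  have h' : Dᵀ * A = 1 := by
    rw [← Matrix.transpose_one, ← h5, Matrix.transpose_mul, Matrix.transpose_transpose]
  have h : A * Dᵀ = 1 := mul_eq_one_comm.1 h'
  refine ⟨A, Dᵀ, Dᵀ * B, h, h', rfl, fun y => ?_, ?_⟩
  · have := hB y
    rwa [← Matrix.mulVec_mulVec, Matrix.mulVec_transpose, ← Matrix.dotProduct_mulVec]
  · apply Units.ext
    rw [coe_siegelElt, ← Matrix.mul_assoc, h, Matrix.one_mul, ← hG, e1, Matrix.transpose_transpose]

theorem exists_eq_siegelElt {g : GL (Fin n ⊕ Fin n) F} (hg : g ∈ stdTriangular F n) :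
    ∃ (A A' X : Matrix (Fin n) (Fin n) F) (h : A * A' = 1) (h' : A' * A = 1),
      A.BlockTriangular id ∧ (∀ y, (X *ᵥ y) ⬝ᵥ y = 0) ∧ g = siegelElt A A' X h h' := by
  obtain ⟨h1, h2⟩ := hg
  replace h1 := mem_weightGroup_zero.1 h1
  obtain ⟨A, A', X, h, h', hA, hX, hg⟩ := exists_eq_siegelElt_of_toBlocks h2 (by
    ext i j
    exact h1.1 (Sum.inr i) (Sum.inl j) (by
      simp only [stdWeight, Sum.elim_inl, Sum.elim_inr]; omega))
  refine ⟨A, A', X, h, h', fun i j hij => ?_, hX, hg⟩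
  rw [hA]
  exact h1.1 (Sum.inl i) (Sum.inl j) hij

theorem mem_stdTriangular_of_toBlocks {g : GL (Fin n ⊕ Fin n) F} (hg : g ∈ evenOrthGroup F n)
    (h0 : (g : Matrix (Fin n ⊕ Fin n) (Fin n ⊕ Fin n) F).toBlocks₂₁ = 0)
    (htri : (g : Matrix (Fin n ⊕ Fin n) (Fin n ⊕ Fin n) F).toBlocks₁₁.BlockTriangular id) :
    g ∈ stdTriangular F n := by
  obtain ⟨A, A', X, h, h', hA, hX, rfl⟩ := exists_eq_siegelElt_of_toBlocks hg h0
  exact siegelElt_mem_stdTriangular h h' (hA ▸ htri) hX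

theorem eval_mem_lineRegular (q a : Polynomial F) :
    (fun t : {t : F // q.eval t ≠ 0} => a.eval t.1) ∈ lineRegular q := ⟨0, a, fun t => by simp⟩

theorem inv_mem_lineRegular (q : Polynomial F) :
    (fun t : {t : F // q.eval t ≠ 0} => (q.eval t.1)⁻¹) ∈ lineRegular q :=
  ⟨1, 1, fun t => by simp [t.2]⟩

open Polynomial in
theorem exists_isPreconnected_of_mem_stdTriangular [Infinite F] {g : GL (Fin n ⊕ Fin n) F}
    (hg : g ∈ stdTriangular F n) :
    ∃ s ⊆ (stdTriangular F n : Set (GL (Fin n ⊕ Fin n) F)), 1 ∈ s ∧ g ∈ s ∧ IsPreconnected s := by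
  obtain ⟨A, A', X, h, h', hA, hX, rfl⟩ := exists_eq_siegelElt hg
  let P : Matrix (Fin n) (Fin n) F[X] := 1 + (Polynomial.X : F[X]) • (A - 1).map Polynomial.C
  let q : F[X] := P.det
  let ev : F → Matrix (Fin n) (Fin n) F[X] → Matrix (Fin n) (Fin n) F :=
    fun t => (Polynomial.evalRingHom t).mapMatrix
  have hevP : ∀ t, ev t P = 1 + t • (A - 1) := by
    intro t
    ext i j
    by_cases hij : i = j <;> simp [ev, P, hij, mul_comm t]
  have hadj : ∀ t, ev t P * ev t P.adjugate = q.eval t • (1 : Matrix (Fin n) (Fin n) F) := by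
    intro t
    simp only [ev]
    rw [← map_mul, Matrix.mul_adjugate]
    ext i j
    by_cases hij : i = j <;> simp [hij, q]
  have hadj' : ∀ t, ev t P.adjugate * ev t P = q.eval t • (1 : Matrix (Fin n) (Fin n) F) := by
    intro t
    simp only [ev]
    rw [← map_mul, Matrix.adjugate_mul]
    ext i j
    by_cases hij : i = j <;> simp [hij, q]
  let f : {t : F // q.eval t ≠ 0} → GL (Fin n ⊕ Fin n) F := fun t =>
    siegelElt (ev t P) ((q.eval t.1)⁻¹ • ev t P.adjugate) (t.1 • X)
      (by rw [Matrix.mul_smul, hadj, smul_smul, inv_mul_cancel₀ t.2, one_smul])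
      (by rw [Matrix.smul_mul, hadj', smul_smul, inv_mul_cancel₀ t.2, one_smul])
  have hq : ∀ t, q.eval t = (1 + t • (A - 1)).det := by
    intro t
    rw [← hevP]
    exact (RingHom.map_det (Polynomial.evalRingHom t) P)
  have hq0 : q.eval 0 ≠ 0 := by rw [hq]; simp
  have hq1 : q.eval 1 ≠ 0 := by
    rw [hq, one_smul, add_sub_cancel]
    exact (Matrix.isUnit_det_of_right_inverse h).ne_zero
  refine ⟨Set.range f, ?_, ⟨⟨0, hq0⟩, ?_⟩, ⟨⟨1, hq1⟩, ?_⟩, ?_⟩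
  · rintro _ ⟨t, rfl⟩
    refine siegelElt_mem_stdTriangular _ _ ?_ fun y => ?_
    · rw [hevP]
      exact Matrix.BlockTriangular.add Matrix.blockTriangular_one
        (fun i j hij => by
          have : j ≠ i := ne_of_lt hij
          simp [hA hij, Matrix.one_apply_ne this.symm])
    · rw [Matrix.smul_mulVec, smul_dotProduct, hX, smul_zero]
  · apply Units.ext
    simp only [f]
    rw [coe_siegelElt]
    have : (q.eval 0)⁻¹ • ev 0 P.adjugate = 1 := by
      have := hadj' 0
      rw [hevP, zero_smul, add_zero, Matrix.mul_one] at this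
      rw [this, smul_smul, inv_mul_cancel₀ hq0, one_smul]
    rw [this, hevP]
    simp
  · apply Units.ext
    simp only [f]
    rw [coe_siegelElt, coe_siegelElt]
    have : (q.eval 1)⁻¹ • ev 1 P.adjugate = A' := by
      have := hadj' 1
      rw [hevP, one_smul, add_sub_cancel] at this
      calc _ = (q.eval 1)⁻¹ • ev 1 P.adjugate * (A * A') := by rw [h, Matrix.mul_one]
        _ = A' := by
          rw [← Matrix.mul_assoc, Matrix.smul_mul, this, smul_smul, inv_mul_cancel₀ hq1, one_smul,
            Matrix.one_mul]
    rw [this, hevP]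
    simp
  · have hev : ∀ (M : Matrix (Fin n) (Fin n) F[X]) i j,
        (fun t : {t : F // q.eval t ≠ 0} => ev t.1 M i j) ∈ lineRegular q :=
      fun M i j => eval_mem_lineRegular q (M i j)
    have hadjm : ∀ i j, (fun t : {t : F // q.eval t ≠ 0} =>
        ((q.eval t.1)⁻¹ • ev t P.adjugate) i j) ∈ lineRegular q :=
      fun i j => mul_mem (inv_mem_lineRegular q) (hev _ i j)
    refine isPreconnected_range_of_lineRegular q ?_ ?_
    · rintro (i | i) (j | j)
      · exact hev P i j
      · have := hev (P * ((Polynomial.X : F[X]) • X.map Polynomial.C)) i j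
        have e : ∀ t, ev t (P * ((Polynomial.X : F[X]) • X.map Polynomial.C)) =
            ev t P * (t • X) := by
          intro t
          simp only [ev, map_mul]
          congr 1
          ext i j
          simp [mul_comm t]
        simp only [e] at this
        exact this
      · exact zero_mem (lineRegular q)
      · exact hadjm j i
    · rintro (i | i) (j | j)
      · exact hadjm i j
      · have := hev (-(((Polynomial.X : F[X]) • X.map Polynomial.C) * Pᵀ)) i j
        have e : ∀ t, ev t (-(((Polynomial.X : F[X]) • X.map Polynomial.C) * Pᵀ)) =
            -((t • X) * (ev t P)ᵀ) := by
          intro t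
          simp only [ev, map_mul, map_neg]
          congr 2
          ext i j
          simp [mul_comm t]
        simp only [e] at this
        exact this
      · exact zero_mem (lineRegular q)
      · exact hev P j i

theorem isConnected_stdTriangular [Infinite F] :
    IsConnected (stdTriangular F n : Set (GL (Fin n ⊕ Fin n) F)) := by
  refine ⟨⟨1, one_mem _⟩, isPreconnected_of_forall 1 fun g hg => ?_⟩
  exact exists_isPreconnected_of_mem_stdTriangular hg

theorem mulVec_mem_glRegular {m : Type*} [DecidableEq m] [Fintype m] (v : m → F) (i : m) :
    (fun g : GL m F => ((g : Matrix m m F) *ᵥ v) i) ∈ glRegular F m := by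
  have := Subalgebra.sum_mem (glRegular F m) (t := Finset.univ)
    (f := fun l (g : GL m F) => (g : Matrix m m F) i l * v l)
    fun l _ => by
      have := Subalgebra.smul_mem _ (entry_mem_glRegular (F := F) i l) (v l)
      convert this using 1
      ext g
      simp [mul_comm]
  convert this using 1
  ext g
  simp [Matrix.mulVec, dotProduct]

theorem isClosed_evenOrthGroup : IsClosed (evenOrthGroup F n : Set (GL (Fin n ⊕ Fin n) F)) := by
  have : (evenOrthGroup F n : Set (GL (Fin n ⊕ Fin n) F)) = ⋂ v : Fin n ⊕ Fin n → F,
      {g : GL (Fin n ⊕ Fin n) F | quadForm F n ((g : Matrix _ _ F) *ᵥ v) - quadForm F n v = 0} := by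
    ext g
    simp only [Set.mem_iInter, Set.mem_ofPred_eq, sub_eq_zero]
    rfl
  rw [this]
  refine isClosed_iInter fun v => isClosed_eq_zero_of_mem_glRegular ?_
  refine sub_mem ?_ ((glRegular F _).algebraMap_mem _)
  have := Subalgebra.sum_mem (glRegular F (Fin n ⊕ Fin n)) (t := Finset.univ)
    (f := fun (i : Fin n) (g : GL (Fin n ⊕ Fin n) F) =>
      (g.val *ᵥ v) (Sum.inl i) * (g.val *ᵥ v) (Sum.inr i))
    fun i _ => mul_mem (mulVec_mem_glRegular v _) (mulVec_mem_glRegular v _)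
  convert this using 1
  ext g
  simp [quadForm]

theorem isClosed_stdTriangular : IsClosed (stdTriangular F n : Set (GL (Fin n ⊕ Fin n) F)) :=
  (isClosed_weightGroup _ _).inter isClosed_evenOrthGroup

theorem isSolvable_stdTriangular : Group.IsSolvable (stdTriangular F n) := by
  have := isSolvable_weightGroup (F := F) (stdWeight_injective (n := n))
  exact Group.isSolvable_of_isSolvable_injective (Subgroup.inclusion_injective
    (inf_le_left : stdTriangular F n ≤ weightGroup F (stdWeight n) 0))

end Siegel

section SpecialOrthogonal

variable {F : Type*} [Field F] {n : ℕ}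

instance Subgroup.continuousInv {G : Type*} [Group G] [TopologicalSpace G] [ContinuousInv G]
    (H : Subgroup G) : ContinuousInv H where
  continuous_inv := (continuous_inv.comp continuous_subtype_val).subtype_mk _

theorem evenSOGroup_eq_map :
    evenSOGroup F n =
      (connectedComponentSubgroup (evenOrthGroup F n)).map (evenOrthGroup F n).subtype := by
  refine Eq.trans ?_ (Subgroup.closure_eq _)
  rfl

theorem evenSOGroup_le : evenSOGroup F n ≤ evenOrthGroup F n := by
  rw [evenSOGroup_eq_map]
  rintro _ ⟨g, -, rfl⟩
  exact g.2

theorem isConnected_evenSOGroup : IsConnected (evenSOGroup F n : Set (GL (Fin n ⊕ Fin n) F)) := by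
  rw [evenSOGroup_eq_map]
  exact isConnected_connectedComponent.image _ continuous_subtype_val.continuousOn

theorem subset_evenSOGroup {s : Set (GL (Fin n ⊕ Fin n) F)} (hs : IsPreconnected s)
    (hsO : s ⊆ evenOrthGroup F n) (h1 : 1 ∈ s) : s ⊆ evenSOGroup F n := by
  intro g hg
  rw [evenSOGroup_eq_map]
  have h2 : IsPreconnected ((↑) ⁻¹' s : Set (evenOrthGroup F n)) := by
    have : Topology.IsInducing ((↑) : evenOrthGroup F n → GL (Fin n ⊕ Fin n) F) :=
      Topology.IsInducing.subtypeVal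
    rw [← this.isPreconnected_image]
    convert hs
    ext x
    refine ⟨?_, fun hx => ⟨⟨x, hsO hx⟩, hx, rfl⟩⟩
    rintro ⟨y, hy, rfl⟩
    exact hy
  exact ⟨⟨g, hsO hg⟩, h2.subset_connectedComponent h1 hg, rfl⟩

theorem continuous_conj {G : Type*} [Group G] [TopologicalSpace G] [SeparatelyContinuousMul G]
    (h : G) : Continuous fun g => h * g * h⁻¹ :=
  (continuous_mul_const h⁻¹).comp (continuous_const_mul h)

theorem mul_mem_glRegular_entry {m : Type*} [DecidableEq m] [Fintype m]
    {f g : GL m F → Matrix m m F} (hf : ∀ i j, (fun x => f x i j) ∈ glRegular F m)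
    (hg : ∀ i j, (fun x => g x i j) ∈ glRegular F m) (i j : m) :
    (fun x => (f x * g x) i j) ∈ glRegular F m := by
  have := Subalgebra.sum_mem (glRegular F m) (t := Finset.univ)
    (f := fun l x => f x i l * g x l j) fun l _ => mul_mem (hf i l) (hg l j)
  convert this using 1
  ext x
  simp [Matrix.mul_apply]

theorem continuous_conj_left {m : Type*} [DecidableEq m] [Fintype m] (u : GL m F) :
    Continuous fun g : GL m F => g * u * g⁻¹ := by
  refine continuous_gl_of_entries (glRegular F m)
    (fun _ => isOpen_ne_zero_of_mem_glRegular) ?_ ?_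
  · simp only [Units.val_mul]
    exact mul_mem_glRegular_entry (mul_mem_glRegular_entry entry_mem_glRegular
      fun i j => (glRegular F m).algebraMap_mem _) inv_entry_mem_glRegular
  · simp only [mul_inv_rev, inv_inv, Units.val_mul]
    exact mul_mem_glRegular_entry entry_mem_glRegular (mul_mem_glRegular_entry
      (fun i j => (glRegular F m).algebraMap_mem _) inv_entry_mem_glRegular)

/-- A conjugacy class of the special orthogonal group is spherical as soon as its elements lying
in a nonempty open set are conjugate under the standard triangular subgroup. -/
theorem isSphericalClass_of_isOpen [Infinite F] (u : evenSOGroup F n)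
    {h : GL (Fin n ⊕ Fin n) F} (hh : h ∈ evenOrthGroup F n)
    {U : Set (GL (Fin n ⊕ Fin n) F)} (hU : IsOpen U) (hmem : h * u * h⁻¹ ∈ U)
    (htrans : ∀ a ∈ evenOrthGroup F n, a * u * a⁻¹ ∈ U →
      ∃ s ∈ stdTriangular F n, s * (h * u * h⁻¹) * s⁻¹ = a * u * a⁻¹) :
    IsSphericalClass (evenSOGroup F n) (conjClass u) := by
  let T : Subgroup (GL (Fin n ⊕ Fin n) F) :=
    (stdTriangular F n).comap (MulAut.conj h).toMonoidHom
  have hT : ∀ g, g ∈ T ↔ h * g * h⁻¹ ∈ stdTriangular F n := fun g => Iff.rfl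
  have hTimage : (T : Set (GL (Fin n ⊕ Fin n) F)) =
      (fun g => h⁻¹ * g * h⁻¹⁻¹) '' stdTriangular F n := by
    ext g
    refine ⟨fun hg => ⟨h * g * h⁻¹, hg, by simp [mul_assoc]⟩, ?_⟩
    rintro ⟨x, hx, rfl⟩
    change _ ∈ T
    rw [hT]
    simpa [mul_assoc] using hx
  have hTconn : IsConnected (T : Set (GL (Fin n ⊕ Fin n) F)) := by
    rw [hTimage]
    exact isConnected_stdTriangular.image _ (continuous_conj _).continuousOn
  have hTO : (T : Set (GL (Fin n ⊕ Fin n) F)) ⊆ evenOrthGroup F n := by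
    rw [hTimage]
    rintro _ ⟨x, hx, rfl⟩
    exact mul_mem (mul_mem (inv_mem hh) hx.2) (inv_mem (inv_mem hh))
  have hTSO : T ≤ evenSOGroup F n := subset_evenSOGroup hTconn.isPreconnected hTO (one_mem T)
  have hTsolv : Group.IsSolvable T := by
    have := isSolvable_stdTriangular (F := F) (n := n)
    refine Group.isSolvable_of_isSolvable_injective
      (f := (MulAut.conj h).toMonoidHom.subgroupComap (stdTriangular F n)) ?_
    intro x y hxy
    have := congrArg Subtype.val hxy
    exact Subtype.ext ((MulAut.conj h).injective this)
  let T' : Subgroup (evenSOGroup F n) := T.subgroupOf (evenSOGroup F n)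
  have hNoeth : TopologicalSpace.NoetherianSpace (evenSOGroup F n) :=
    Topology.IsInducing.subtypeVal.noetherianSpace
  obtain ⟨B, hB, hTB⟩ := exists_isBorel_ge (S := T')
    (topologicalKrullDim_gl_subgroup_ne_top (evenSOGroup F n))
    ((isClosed_stdTriangular.preimage (continuous_conj h)).preimage continuous_subtype_val) (by
      have := (Topology.IsInducing.subtypeVal
        (t := {x | x ∈ evenSOGroup F n})).isPreconnected_image (s := (T' : Set (evenSOGroup F n)))
      refine ⟨⟨1, one_mem _⟩, this.1 ?_⟩
      convert hTconn.isPreconnected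
      ext g
      refine ⟨?_, fun hg => ⟨⟨g, hTSO hg⟩, hg, rfl⟩⟩
      rintro ⟨x, hx, rfl⟩
      exact hx)
    (by
      refine Group.isSolvable_of_isSolvable_injective
        (f := (evenSOGroup F n).subtype.subgroupComap T) ?_
      intro x y hxy
      have := congrArg (fun z : T => (z : GL (Fin n ⊕ Fin n) F)) hxy
      exact Subtype.ext (Subtype.ext this))
  refine ⟨B, hB, u, IsConj.refl u, ?_⟩
  intro v hv
  rw [mem_closure_iff]
  intro W hW hvW
  let c : evenSOGroup F n → evenSOGroup F n := fun g => g * u * g⁻¹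
  have hc : Continuous c :=
    ((continuous_conj_left (u : GL (Fin n ⊕ Fin n) F)).comp
      continuous_subtype_val).subtype_mk _
  have hconn : ConnectedSpace (evenSOGroup F n) :=
    isConnected_iff_connectedSpace.1 isConnected_evenSOGroup
  have hirr := irreducibleSpace_of_connectedSpace (evenSOGroup F n)
  obtain ⟨g, hg⟩ := isConj_iff.1 hv
  have hU' : IsOpen {w : evenSOGroup F n | h * w * h⁻¹ ∈ U} :=
    (hU.preimage (continuous_conj h)).preimage continuous_subtype_val
  obtain ⟨a, haW, haU⟩ := nonempty_preirreducible_inter (hW.preimage hc) (hU'.preimage hc)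
    ⟨g, show g * u * g⁻¹ ∈ W by rwa [hg]⟩ ⟨1, show h * _ * h⁻¹ ∈ U by simpa [c] using hmem⟩
  obtain ⟨s, hs, hsu⟩ := htrans (h * a) (mul_mem hh (evenSOGroup_le a.2)) (by
    have : h * ((a * u * a⁻¹ : evenSOGroup F n) : GL (Fin n ⊕ Fin n) F) * h⁻¹ ∈ U := haU
    simpa [mul_assoc] using this)
  have hsT : h⁻¹ * s * h ∈ T := by
    rw [hT]
    simpa [mul_assoc] using hs
  refine ⟨c a, haW, ⟨⟨_, hTSO hsT⟩, hTB hsT, ?_⟩⟩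
  apply Subtype.ext
  simp only [c, Subgroup.coe_mul, Subgroup.coe_inv]
  have h3 := congrArg (fun x => h⁻¹ * x * h) hsu
  simp only [mul_inv_rev, mul_assoc, inv_mul_cancel_left, inv_mul_cancel, mul_one] at h3
  simp only [mul_inv_rev, inv_inv, mul_assoc]
  exact h3.symm

end SpecialOrthogonal

section HyperbolicSystems

variable {F : Type*} [Field F] {n : ℕ}

/-- The polar form of the standard quadratic form. -/
def hypForm (F : Type*) [Field F] (n : ℕ) : LinearMap.BilinForm F (Fin n ⊕ Fin n → F) :=
  LinearMap.mk₂ F (fun x y => ∑ i, (x (.inl i) * y (.inr i) + x (.inr i) * y (.inl i)))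
    (fun x x' y => by
      rw [← Finset.sum_add_distrib]
      exact Finset.sum_congr rfl fun i _ => by simp only [Pi.add_apply]; ring)
    (fun c x y => by
      rw [smul_eq_mul, Finset.mul_sum]
      exact Finset.sum_congr rfl fun i _ => by simp only [Pi.smul_apply, smul_eq_mul]; ring)
    (fun x y y' => by
      rw [← Finset.sum_add_distrib]
      exact Finset.sum_congr rfl fun i _ => by simp only [Pi.add_apply]; ring)
    (fun c x y => by
      rw [smul_eq_mul, Finset.mul_sum]
      exact Finset.sum_congr rfl fun i _ => by simp only [Pi.smul_apply, smul_eq_mul]; ring)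

theorem hypForm_apply (x y : Fin n ⊕ Fin n → F) :
    hypForm F n x y = ∑ i, (x (.inl i) * y (.inr i) + x (.inr i) * y (.inl i)) := rfl

theorem hypForm_sumElim (x y x' y' : Fin n → F) :
    hypForm F n (Sum.elim x y) (Sum.elim x' y') = x ⬝ᵥ y' + y ⬝ᵥ x' := by
  simp [hypForm_apply, dotProduct, Finset.sum_add_distrib]

theorem hypForm_comm (x y : Fin n ⊕ Fin n → F) : hypForm F n x y = hypForm F n y x := by
  rw [hypForm_apply, hypForm_apply]
  exact Finset.sum_congr rfl fun i _ => by ring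

theorem quadForm_add (x y : Fin n ⊕ Fin n → F) :
    quadForm F n (x + y) = quadForm F n x + quadForm F n y + hypForm F n x y := by
  rw [hypForm_apply, quadForm, quadForm, quadForm, ← Finset.sum_add_distrib,
    ← Finset.sum_add_distrib]
  exact Finset.sum_congr rfl fun i _ => by simp only [Pi.add_apply]; ring

theorem quadForm_smul (c : F) (x : Fin n ⊕ Fin n → F) :
    quadForm F n (c • x) = c ^ 2 * quadForm F n x := by
  rw [quadForm, quadForm, Finset.mul_sum]
  exact Finset.sum_congr rfl fun i _ => by simp only [Pi.smul_apply, smul_eq_mul]; ring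

theorem hypForm_self [CharP F 2] (x : Fin n ⊕ Fin n → F) : hypForm F n x x = 0 := by
  rw [hypForm_apply]
  exact Finset.sum_eq_zero fun i _ => by rw [mul_comm (x (.inr i)), CharTwo.add_self_eq_zero]

theorem eq_zero_of_hypForm {x : Fin n ⊕ Fin n → F} (h : ∀ y, hypForm F n x y = 0) : x = 0 := by
  ext (i | i)
  · simpa [hypForm_apply, Pi.single_apply] using h (Pi.single (.inr i) 1)
  · simpa [hypForm_apply, Pi.single_apply] using h (Pi.single (.inl i) 1)

theorem exists_hypForm_eq_one {x : Fin n ⊕ Fin n → F} (h : x ≠ 0) : ∃ y, hypForm F n x y = 1 := by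
  by_contra! hx
  refine h (eq_zero_of_hypForm fun y => ?_)
  by_contra hy
  exact hx ((hypForm F n x y)⁻¹ • y) (by simp [hy])

/-- The first `m` terms of the sequences `a` and `b` form a system of hyperbolic pairs. -/
structure IsHyperbolicSystem (a b : ℕ → Fin n ⊕ Fin n → F) (m : ℕ) : Prop where
  quad_left : ∀ i < m, quadForm F n (a i) = 0
  quad_right : ∀ i < m, quadForm F n (b i) = 0
  left_left : ∀ i < m, ∀ j < m, hypForm F n (a i) (a j) = 0
  right_right : ∀ i < m, ∀ j < m, hypForm F n (b i) (b j) = 0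
  left_right : ∀ i < m, ∀ j < m, hypForm F n (a i) (b j) = if i = j then 1 else 0

/-- The orthogonal of the first `m` terms of the sequences `a` and `b`. -/
def hypOrthogonal (a b : ℕ → Fin n ⊕ Fin n → F) (m : ℕ) : Submodule F (Fin n ⊕ Fin n → F) where
  carrier := {x | ∀ i < m, hypForm F n x (a i) = 0 ∧ hypForm F n x (b i) = 0}
  add_mem' hx hy i hi := by
    simp [(hx i hi).1, (hx i hi).2, (hy i hi).1, (hy i hi).2]
  zero_mem' i _ := by simp
  smul_mem' c x hx i hi := by simp [(hx i hi).1, (hx i hi).2]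

theorem hypForm_eq_zero_of_mem_hypOrthogonal {a b : ℕ → Fin n ⊕ Fin n → F} {m : ℕ}
    {x : Fin n ⊕ Fin n → F} (hx : x ∈ hypOrthogonal a b m) {i : ℕ} (hi : i < m) :
    hypForm F n x (a i) = 0 ∧ hypForm F n x (b i) = 0 := hx i hi

namespace IsHyperbolicSystem

variable {a b : ℕ → Fin n ⊕ Fin n → F} {m : ℕ}

theorem right_left (h : IsHyperbolicSystem a b m) {i j : ℕ} (hi : i < m) (hj : j < m) :
    hypForm F n (b i) (a j) = if i = j then 1 else 0 := by
  rw [hypForm_comm, h.left_right j hj i hi]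
  simp [eq_comm]

theorem hypForm_sum (h : IsHyperbolicSystem a b m) (c d : ℕ → F) {j : ℕ} (hj : j < m) :
    hypForm F n (∑ i ∈ Finset.range m, (c i • a i + d i • b i)) (a j) = d j ∧
    hypForm F n (∑ i ∈ Finset.range m, (c i • a i + d i • b i)) (b j) = c j := by
  simp only [map_sum, LinearMap.sum_apply, map_add, LinearMap.add_apply, map_smul,
    LinearMap.smul_apply, smul_eq_mul]
  constructor
  · rw [Finset.sum_eq_single j]
    · simp [h.left_left j hj j hj, h.right_left hj hj]
    · intro i hi hij
      rw [Finset.mem_range] at hi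
      simp [h.left_left i hi j hj, h.right_left hi hj, hij]
    · simp [hj]
  · rw [Finset.sum_eq_single j]
    · simp [h.right_right j hj j hj, h.left_right j hj j hj]
    · intro i hi hij
      rw [Finset.mem_range] at hi
      simp [h.right_right i hi j hj, h.left_right i hi j hj, hij]
    · simp [hj]

theorem exists_sub_mem_hypOrthogonal (h : IsHyperbolicSystem a b m) (x : Fin n ⊕ Fin n → F) :
    ∃ c d : ℕ → F, x - ∑ i ∈ Finset.range m, (c i • a i + d i • b i) ∈ hypOrthogonal a b m := by
  refine ⟨fun i => hypForm F n x (b i), fun i => hypForm F n x (a i), fun j hj => ?_⟩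
  have := h.hypForm_sum (fun i => hypForm F n x (b i)) (fun i => hypForm F n x (a i)) hj
  rw [map_sub, LinearMap.sub_apply, LinearMap.sub_apply, this.1, this.2]
  simp

theorem exists_mem_hypOrthogonal_eq_one (h : IsHyperbolicSystem a b m) {x : Fin n ⊕ Fin n → F}
    (hx : x ∈ hypOrthogonal a b m) (hx0 : x ≠ 0) :
    ∃ y ∈ hypOrthogonal a b m, hypForm F n x y = 1 := by
  obtain ⟨y, hy⟩ := exists_hypForm_eq_one hx0
  obtain ⟨c, d, hcd⟩ := h.exists_sub_mem_hypOrthogonal y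
  refine ⟨_, hcd, ?_⟩
  rw [map_sub, hy, map_sum, Finset.sum_eq_zero, sub_zero]
  intro i hi
  have := hx i (Finset.mem_range.1 hi)
  simp [this.1, this.2]

theorem le (h : IsHyperbolicSystem a b m) : m ≤ n := by
  let φ : (Fin n ⊕ Fin n → F) →ₗ[F] (Fin m → F) × (Fin m → F) :=
    (LinearMap.pi fun i : Fin m => (hypForm F n).flip (a i)).prod
      (LinearMap.pi fun i : Fin m => (hypForm F n).flip (b i))
  have hφ : Function.Surjective φ := by
    rintro ⟨c, d⟩
    let e : (Fin m → F) → ℕ → F := fun c i => if hi : i < m then c ⟨i, hi⟩ else 0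
    refine ⟨∑ i ∈ Finset.range m, (e d i • a i + e c i • b i), ?_⟩
    ext i
    · exact ((h.hypForm_sum (e d) (e c) i.2).1).trans (dif_pos i.2)
    · exact ((h.hypForm_sum (e d) (e c) i.2).2).trans (dif_pos i.2)
  have := LinearMap.finrank_le_finrank_of_surjective hφ
  simp at this
  omega

theorem hypOrthogonal_ne_bot (a b : ℕ → Fin n ⊕ Fin n → F) (hm : m < n) :
    ∃ x ∈ hypOrthogonal a b m, x ≠ 0 := by
  let φ : (Fin n ⊕ Fin n → F) →ₗ[F] (Fin m → F) × (Fin m → F) :=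
    (LinearMap.pi fun i : Fin m => (hypForm F n).flip (a i)).prod
      (LinearMap.pi fun i : Fin m => (hypForm F n).flip (b i))
  have hφ : LinearMap.ker φ ≠ ⊥ := by
    apply LinearMap.ker_ne_bot_of_finrank_lt
    simp
    omega
  obtain ⟨x, hx, hx0⟩ := (Submodule.ne_bot_iff _).1 hφ
  refine ⟨x, fun i hi => ?_, hx0⟩
  rw [LinearMap.mem_ker] at hx
  exact ⟨congrFun (congrArg Prod.fst hx) ⟨i, hi⟩, congrFun (congrArg Prod.snd hx) ⟨i, hi⟩⟩

theorem congr {a' b' : ℕ → Fin n ⊕ Fin n → F} (h : IsHyperbolicSystem a b m)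
    (ha : ∀ i < m, a' i = a i) (hb : ∀ i < m, b' i = b i) : IsHyperbolicSystem a' b' m where
  quad_left i hi := by rw [ha i hi, h.quad_left i hi]
  quad_right i hi := by rw [hb i hi, h.quad_right i hi]
  left_left i hi j hj := by rw [ha i hi, ha j hj, h.left_left i hi j hj]
  right_right i hi j hj := by rw [hb i hi, hb j hj, h.right_right i hi j hj]
  left_right i hi j hj := by rw [ha i hi, hb j hj, h.left_right i hi j hj]

theorem succ [CharP F 2] (h : IsHyperbolicSystem a b m) (ha : a m ∈ hypOrthogonal a b m)
    (hb : b m ∈ hypOrthogonal a b m) (hqa : quadForm F n (a m) = 0)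
    (hqb : quadForm F n (b m) = 0) (hab : hypForm F n (a m) (b m) = 1) :
    IsHyperbolicSystem a b (m + 1) where
  quad_left i hi := by
    rcases Nat.lt_succ_iff_lt_or_eq.1 hi with hi | rfl
    exacts [h.quad_left i hi, hqa]
  quad_right i hi := by
    rcases Nat.lt_succ_iff_lt_or_eq.1 hi with hi | rfl
    exacts [h.quad_right i hi, hqb]
  left_left i hi j hj := by
    rcases Nat.lt_succ_iff_lt_or_eq.1 hi with hi | rfl <;>
      rcases Nat.lt_succ_iff_lt_or_eq.1 hj with hj | rfl
    exacts [h.left_left i hi j hj, hypForm_comm (F := F) _ _ ▸ (ha i hi).1, (ha j hj).1,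
      hypForm_self _]
  right_right i hi j hj := by
    rcases Nat.lt_succ_iff_lt_or_eq.1 hi with hi | rfl <;>
      rcases Nat.lt_succ_iff_lt_or_eq.1 hj with hj | rfl
    exacts [h.right_right i hi j hj, hypForm_comm (F := F) _ _ ▸ (hb i hi).2, (hb j hj).2,
      hypForm_self _]
  left_right i hi j hj := by
    rcases Nat.lt_succ_iff_lt_or_eq.1 hi with hi | rfl <;>
      rcases Nat.lt_succ_iff_lt_or_eq.1 hj with hj | rfl
    · exact h.left_right i hi j hj
    · rw [if_neg hi.ne, hypForm_comm, (hb i hi).1]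
    · rw [if_neg hj.ne', (ha j hj).2]
    · rw [if_pos rfl, hab]

theorem exists_succ [CharP F 2] (h : IsHyperbolicSystem a b m) {s t : Fin n ⊕ Fin n → F}
    (hs : s ∈ hypOrthogonal a b m) (ht : t ∈ hypOrthogonal a b m)
    (hqs : quadForm F n s = 0) (hqt : quadForm F n t = 0) (hst : hypForm F n s t = 1) :
    IsHyperbolicSystem (Function.update a m s) (Function.update b m t) (m + 1) := by
  have ha : ∀ i < m, Function.update a m s i = a i :=
    fun i hi => Function.update_of_ne hi.ne _ _
  have hb : ∀ i < m, Function.update b m t i = b i :=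
    fun i hi => Function.update_of_ne hi.ne _ _
  have horth : hypOrthogonal (Function.update a m s) (Function.update b m t) m =
      hypOrthogonal a b m := by
    ext x
    refine forall₂_congr fun i hi => ?_
    rw [ha i hi, hb i hi]
  refine (h.congr ha hb).succ ?_ ?_ ?_ ?_ ?_ <;> simpa [horth]

theorem exists_singular_pair [IsAlgClosed F] [CharP F 2] (h : IsHyperbolicSystem a b m)
    (hm : m < n) : ∃ s ∈ hypOrthogonal a b m, ∃ t ∈ hypOrthogonal a b m,
      quadForm F n s = 0 ∧ quadForm F n t = 0 ∧ hypForm F n s t = 1 := by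
  have key : ∀ s ∈ hypOrthogonal a b m, ∀ t ∈ hypOrthogonal a b m, quadForm F n s = 0 →
      hypForm F n s t = 1 → ∃ s ∈ hypOrthogonal a b m, ∃ t ∈ hypOrthogonal a b m,
      quadForm F n s = 0 ∧ quadForm F n t = 0 ∧ hypForm F n s t = 1 := by
    intro s hs t ht hq hst
    refine ⟨s, hs, t + quadForm F n t • s, add_mem ht (Submodule.smul_mem _ _ hs), hq, ?_, ?_⟩
    · rw [quadForm_add, quadForm_smul, hq, map_smul, hypForm_comm, hst]
      simp [CharTwo.add_self_eq_zero]
    · rw [map_add, map_smul, hst, hypForm_self]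
      simp
  obtain ⟨s, hs, hs0⟩ := hypOrthogonal_ne_bot a b hm
  obtain ⟨t, ht, hst⟩ := h.exists_mem_hypOrthogonal_eq_one hs hs0
  by_cases hqt : quadForm F n t = 0
  · exact key t ht s hs hqt (by rw [hypForm_comm, hst])
  · obtain ⟨c, hc⟩ := IsAlgClosed.exists_root
      (Polynomial.C (quadForm F n t) * Polynomial.X ^ 2 + Polynomial.C 1 * Polynomial.X +
        Polynomial.C (quadForm F n s))
      (by rw [Polynomial.degree_quadratic hqt]; decide)
    refine key (s + c • t) (add_mem hs (Submodule.smul_mem _ _ ht)) t ht ?_ ?_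
    · rw [quadForm_add, quadForm_smul, map_smul, hst, ← hc]
      simp
      ring
    · simp [hst, hypForm_self]

theorem exists_extension [IsAlgClosed F] [CharP F 2] (h : IsHyperbolicSystem a b m) :
    ∃ a' b', IsHyperbolicSystem a' b' n ∧ (∀ i < m, a' i = a i) ∧ ∀ i < m, b' i = b i := by
  have key : ∀ l, m ≤ l → l ≤ n → ∃ a' b', IsHyperbolicSystem a' b' l ∧ (∀ i < m, a' i = a i) ∧
      ∀ i < m, b' i = b i := by
    intro l hl
    induction l, hl using Nat.le_induction with
    | base => exact fun _ => ⟨a, b, h, fun _ _ => rfl, fun _ _ => rfl⟩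
    | succ l hl ih =>
      intro hln
      obtain ⟨a', b', h', ha, hb⟩ := ih (by omega)
      obtain ⟨s, hs, t, ht, hqs, hqt, hst⟩ := h'.exists_singular_pair (by omega)
      refine ⟨_, _, h'.exists_succ hs ht hqs hqt hst, fun i hi => ?_, fun i hi => ?_⟩
      · rw [Function.update_of_ne (by omega), ha i hi]
      · rw [Function.update_of_ne (by omega), hb i hi]
  exact key n h.le le_rfl

end IsHyperbolicSystem

end HyperbolicSystems

section AdaptedSystems

variable {F : Type*} [Field F] {n : ℕ}

/-- The conditions on a linear map `N` for `1 + N` to be an isometry of square one, in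
characteristic two. -/
structure IsOrthNilpotent (N : (Fin n ⊕ Fin n → F) →ₗ[F] (Fin n ⊕ Fin n → F)) : Prop where
  sq : ∀ x, N (N x) = 0
  symm : ∀ x y, hypForm F n (N x) y = hypForm F n x (N y)
  quad : ∀ x, quadForm F n (N x) = hypForm F n x (N x)

/-- A hyperbolic system on which the nilpotent part `N` of an involution has a standard form. -/
structure IsAdaptedSystem (N : (Fin n ⊕ Fin n → F) →ₗ[F] (Fin n ⊕ Fin n → F)) (σ : ℕ → ℕ) (ε : F)
    (a b : ℕ → Fin n ⊕ Fin n → F) (m : ℕ) : Prop extends IsHyperbolicSystem a b m where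
  lt : ∀ i < m, σ i < m
  invol : ∀ i < m, σ (σ i) = i
  map_left : ∀ i < m, N (a i) = b (σ i) + ε • a (σ i)

/-- The fixed-point free involution exchanging `2 * i` and `2 * i + 1`. -/
def flipParity (i : ℕ) : ℕ := if Even i then i + 1 else i - 1

theorem flipParity_of_even {i : ℕ} (h : Even i) : flipParity i = i + 1 := if_pos h

theorem flipParity_succ_of_even {i : ℕ} (h : Even i) : flipParity (i + 1) = i := by
  rw [flipParity, if_neg (by simpa [Nat.even_add_one] using h), Nat.add_sub_cancel]

theorem flipParity_flipParity (i : ℕ) : flipParity (flipParity i) = i := by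
  rcases Nat.even_or_odd' i with ⟨k, rfl | rfl⟩
  · rw [flipParity_of_even (even_two_mul k), flipParity_succ_of_even (even_two_mul k)]
  · rw [flipParity_succ_of_even (even_two_mul k), flipParity_of_even (even_two_mul k)]

theorem flipParity_lt {i m : ℕ} (hm : Even m) (hi : i < m) : flipParity i < m := by
  obtain ⟨l, rfl⟩ := hm
  rcases Nat.even_or_odd' i with ⟨k, rfl | rfl⟩
  · rw [flipParity_of_even (even_two_mul k)]; omega
  · rw [flipParity_succ_of_even (even_two_mul k)]; omega

theorem flipParity_ne (i : ℕ) : flipParity i ≠ i := by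
  rcases Nat.even_or_odd' i with ⟨k, rfl | rfl⟩
  · rw [flipParity_of_even (even_two_mul k)]; omega
  · rw [flipParity_succ_of_even (even_two_mul k)]; omega

theorem le_flipParity {i j : ℕ} (h : j < i) : j ≤ flipParity i := by
  rcases Nat.even_or_odd' i with ⟨k, rfl | rfl⟩
  · rw [flipParity_of_even (even_two_mul k)]; omega
  · rw [flipParity_succ_of_even (even_two_mul k)]; omega

theorem mem_hypOrthogonal_update {a b : ℕ → Fin n ⊕ Fin n → F} {m : ℕ}
    {s t x : Fin n ⊕ Fin n → F} :
    x ∈ hypOrthogonal (Function.update a m s) (Function.update b m t) (m + 1) ↔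
      x ∈ hypOrthogonal a b m ∧ hypForm F n x s = 0 ∧ hypForm F n x t = 0 := by
  constructor
  · refine fun h => ⟨fun i hi => ?_, ?_⟩
    · have := hypForm_eq_zero_of_mem_hypOrthogonal h (Nat.lt_succ_of_lt hi)
      rwa [Function.update_of_ne hi.ne, Function.update_of_ne hi.ne] at this
    · have := hypForm_eq_zero_of_mem_hypOrthogonal h (Nat.lt_succ_self m)
      rwa [Function.update_self, Function.update_self] at this
  · rintro ⟨h, hst⟩ i hi
    rcases Nat.lt_succ_iff_lt_or_eq.1 hi with hi | rfl
    · rw [Function.update_of_ne hi.ne, Function.update_of_ne hi.ne]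
      exact h i hi
    · rwa [Function.update_self, Function.update_self]

variable {N : (Fin n ⊕ Fin n → F) →ₗ[F] (Fin n ⊕ Fin n → F)}

namespace IsAdaptedSystem

variable {σ : ℕ → ℕ} {ε : F} {a b : ℕ → Fin n ⊕ Fin n → F} {m : ℕ}

theorem map_right (h : IsAdaptedSystem N σ ε a b m) (hN : IsOrthNilpotent N) {i : ℕ} (hi : i < m) :
    N (b i) = -(ε • N (a i)) := by
  have h1 := h.map_left (σ i) (h.lt i hi)
  rw [h.invol i hi] at h1
  have h2 := congrArg N h1
  rw [hN.sq, map_add, map_smul] at h2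
  exact eq_neg_of_add_eq_zero_left h2.symm

theorem map_mem_hypOrthogonal (h : IsAdaptedSystem N σ ε a b m) (hN : IsOrthNilpotent N)
    {x : Fin n ⊕ Fin n → F} (hx : x ∈ hypOrthogonal a b m) : N x ∈ hypOrthogonal a b m := by
  have key : ∀ i < m, hypForm F n x (N (a i)) = 0 := by
    intro i hi
    have := hypForm_eq_zero_of_mem_hypOrthogonal hx (h.lt i hi)
    rw [h.map_left i hi, map_add, map_smul, this.1, this.2, smul_zero, add_zero]
  intro i hi
  rw [hN.symm, hN.symm, key i hi, h.map_right hN hi, map_neg, map_smul, key i hi]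
  simp

theorem exists_mem_hypOrthogonal_map_eq_one (h : IsAdaptedSystem N σ ε a b m)
    (hN : IsOrthNilpotent N) {z : Fin n ⊕ Fin n → F} (hz : z ∈ hypOrthogonal a b m)
    (hz0 : N z ≠ 0) : ∃ y ∈ hypOrthogonal a b m, hypForm F n z (N y) = 1 := by
  obtain ⟨y, hy, hzy⟩ :=
    h.exists_mem_hypOrthogonal_eq_one (h.map_mem_hypOrthogonal hN hz) hz0
  exact ⟨y, hy, by rw [← hN.symm, hzy]⟩

end IsAdaptedSystem

namespace IsOrthNilpotent

theorem form_comm (hN : IsOrthNilpotent N) (x y : Fin n ⊕ Fin n → F) :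
    hypForm F n x (N y) = hypForm F n y (N x) := by
  rw [← hN.symm, hypForm_comm]

theorem form_map_left (hN : IsOrthNilpotent N) (x y : Fin n ⊕ Fin n → F) :
    hypForm F n (N x) (N y) = 0 := by
  rw [hN.symm, hN.sq, map_zero]

theorem exists_singular [IsAlgClosed F] (hN : IsOrthNilpotent N) {x : Fin n ⊕ Fin n → F}
    (hx : hypForm F n x (N x) ≠ 0) : ∃ c : F, quadForm F n (x + c • N x) = 0 := by
  obtain ⟨c, hc⟩ := IsAlgClosed.exists_root
    (Polynomial.C (hypForm F n x (N x)) * Polynomial.X ^ 2 +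
      Polynomial.C (hypForm F n x (N x)) * Polynomial.X + Polynomial.C (quadForm F n x))
    (by rw [Polynomial.degree_quadratic hx]; decide)
  refine ⟨c, ?_⟩
  rw [quadForm_add, quadForm_smul, hN.quad, map_smul, ← hc]
  simp
  ring

theorem form_add_smul_map (hN : IsOrthNilpotent N) (x y : Fin n ⊕ Fin n → F) (c : F) :
    hypForm F n (x + c • N x) (N y) = hypForm F n x (N y) := by
  simp [hN.form_map_left]

/-- A singular vector on which the form attached to an involution does not vanish extends an
adapted system. -/
theorem isAdaptedSystem_succ [CharP F 2] (hN : IsOrthNilpotent N)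
    {a b : ℕ → Fin n ⊕ Fin n → F} {m : ℕ} (h : IsAdaptedSystem N id 1 a b m)
    {s : Fin n ⊕ Fin n → F} (hs : s ∈ hypOrthogonal a b m) (hq : quadForm F n s = 0)
    (hf : hypForm F n s (N s) = 1) :
    IsAdaptedSystem N id 1 (Function.update a m s) (Function.update b m (N s + s)) (m + 1) where
  toIsHyperbolicSystem := h.exists_succ hs (add_mem (h.map_mem_hypOrthogonal hN hs) hs) hq
    (by rw [quadForm_add, hN.quad, hf, hq, hypForm_comm, hf, add_zero, CharTwo.add_self_eq_zero])
    (by rw [map_add, hf, hypForm_self, add_zero])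
  lt i hi := hi
  invol i _ := rfl
  map_left i hi := by
    rcases Nat.lt_succ_iff_lt_or_eq.1 hi with hi | rfl
    · simpa [Function.update_of_ne hi.ne] using h.map_left i hi
    · simp only [Function.update_self, id_eq, one_smul, add_assoc]
      rw [show s + s = 0 from funext fun _ => CharTwo.add_self_eq_zero _, add_zero]

theorem exists_isAdaptedSystem_succ [IsAlgClosed F] [CharP F 2] (hN : IsOrthNilpotent N)
    {a b : ℕ → Fin n ⊕ Fin n → F} {m : ℕ} (h : IsAdaptedSystem N id 1 a b m)
    {x : Fin n ⊕ Fin n → F} (hx : x ∈ hypOrthogonal a b m) (hxx : hypForm F n x (N x) ≠ 0) :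
    ∃ a' b', IsAdaptedSystem N id 1 a' b' (m + 1) ∧ ((∀ x ∈ hypOrthogonal a' b' (m + 1), N x = 0) ∨
      ∃ x ∈ hypOrthogonal a' b' (m + 1), hypForm F n x (N x) ≠ 0) := by
  obtain ⟨s, hs, hqs, hfs⟩ : ∃ s ∈ hypOrthogonal a b m, quadForm F n s = 0 ∧
      hypForm F n s (N s) = 1 := by
    obtain ⟨c, hc⟩ := hN.exists_singular hxx
    obtain ⟨d, hd⟩ := IsAlgClosed.exists_pow_nat_eq (hypForm F n x (N x)) two_pos
    have hd0 : d ≠ 0 := by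
      rintro rfl
      exact hxx (by simp [← hd])
    refine ⟨d⁻¹ • (x + c • N x), Submodule.smul_mem _ _
      (add_mem hx (Submodule.smul_mem _ _ (h.map_mem_hypOrthogonal hN hx))), ?_, ?_⟩
    · rw [quadForm_smul, hc, mul_zero]
    · simp only [map_smul, LinearMap.smul_apply, map_add, hN.sq, smul_zero, add_zero, smul_eq_mul,
        LinearMap.add_apply, hN.form_map_left, mul_zero, ← hd]
      field_simp
  have h' := hN.isAdaptedSystem_succ h hs hqs hfs
  by_cases hK : ∃ x ∈ hypOrthogonal (Function.update a m s) (Function.update b m (N s + s)) (m + 1),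
      hypForm F n x (N x) ≠ 0
  · exact ⟨_, _, h', Or.inr hK⟩
  push Not at hK
  by_cases hK0 : ∀ x ∈ hypOrthogonal (Function.update a m s) (Function.update b m (N s + s))
      (m + 1), N x = 0
  · exact ⟨_, _, h', Or.inl hK0⟩
  push Not at hK0
  obtain ⟨z, hz, hz0⟩ := hK0
  obtain ⟨w, hw, hzw⟩ := h'.exists_mem_hypOrthogonal_map_eq_one hN hz hz0
  have hzz := hK z hz
  have hww := hK w hw
  rw [mem_hypOrthogonal_update] at hz hw
  have hzs : hypForm F n z (N s) = 0 := by
    have := hz.2.2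
    rwa [map_add, hz.2.1, add_zero] at this
  have hws : hypForm F n w (N s) = 0 := by
    have := hw.2.2
    rwa [map_add, hw.2.1, add_zero] at this
  have hsz : hypForm F n s (N z) = 0 := by rw [hN.form_comm, hzs]
  have hsw : hypForm F n s (N w) = 0 := by rw [hN.form_comm, hws]
  have hX : hypForm F n (s + z) (N (s + z)) = 1 := by
    simp [hfs, hzs, hsz, hzz]
  obtain ⟨c, hc⟩ := hN.exists_singular (x := s + z) (by rw [hX]; exact one_ne_zero)
  set X := s + z + c • N (s + z) with hXdef
  have hNX : N X = N (s + z) := by rw [hXdef, map_add, map_smul, hN.sq, smul_zero, add_zero]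
  have hXK : X ∈ hypOrthogonal a b m := by
    have := add_mem hs hz.1
    exact add_mem this (Submodule.smul_mem _ _ (h.map_mem_hypOrthogonal hN this))
  have hXX : hypForm F n X (N X) = 1 := by rw [hNX, hXdef, hN.form_add_smul_map, hX]
  refine ⟨_, _, hN.isAdaptedSystem_succ h hXK hc hXX, Or.inr
    ⟨s + w + hypForm F n (s + w) X • N X, ?_, ?_⟩⟩
  · have h1 : hypForm F n (s + w + hypForm F n (s + w) X • N X) X = 0 := by
      rw [map_add (hypForm F n), map_smul (hypForm F n), LinearMap.add_apply,
        LinearMap.smul_apply, hypForm_comm (N X), hXX, smul_eq_mul, mul_one,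
        CharTwo.add_self_eq_zero]
    have h2 : hypForm F n (s + w + hypForm F n (s + w) X • N X) (N X) = 0 := by
      rw [map_add (hypForm F n), map_smul (hypForm F n), LinearMap.add_apply,
        LinearMap.smul_apply, hN.form_map_left, smul_zero, add_zero, hNX]
      simp only [map_add, LinearMap.add_apply, hfs, hsz, hws, hN.form_comm w z, hzw]
      simp [CharTwo.add_self_eq_zero]
    rw [mem_hypOrthogonal_update]
    refine ⟨add_mem (add_mem hs hw.1) (Submodule.smul_mem _ _ (h.map_mem_hypOrthogonal hN hXK)),
      h1, ?_⟩
    rw [map_add, h1, h2, add_zero]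
  · have : N (s + w + hypForm F n (s + w) X • N X) = N (s + w) := by
      rw [map_add N, map_smul, hN.sq, smul_zero, add_zero]
    rw [this, map_add, LinearMap.add_apply, map_smul, LinearMap.smul_apply, hN.form_map_left]
    simp [hfs, hsw, hws, hww]

theorem exists_isAdaptedSystem_of_ne [IsAlgClosed F] [CharP F 2] (hN : IsOrthNilpotent N)
    {x : Fin n ⊕ Fin n → F} (hx : hypForm F n x (N x) ≠ 0) :
    ∃ (a b : ℕ → Fin n ⊕ Fin n → F) (r : ℕ), IsAdaptedSystem N id 1 a b r ∧
      ∀ x ∈ hypOrthogonal a b r, N x = 0 := by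
  by_contra! hne
  have key : ∀ m : ℕ, ∃ a b, IsAdaptedSystem N id 1 a b m ∧
      ∃ x ∈ hypOrthogonal a b m, hypForm F n x (N x) ≠ 0 := by
    intro m
    induction m with
    | zero =>
      refine ⟨0, 0, ⟨⟨?_, ?_, ?_, ?_, ?_⟩, ?_, ?_, ?_⟩, x, ?_, hx⟩
      all_goals exact fun i hi => absurd hi (Nat.not_lt_zero i)
    | succ m ih =>
      obtain ⟨a, b, h, x, hx, hxx⟩ := ih
      obtain ⟨a', b', h', h0 | h0⟩ := hN.exists_isAdaptedSystem_succ h hx hxx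
      · obtain ⟨y, hy, hy0⟩ := hne a' b' _ h'
        exact absurd (h0 y hy) hy0
      · exact ⟨a', b', h', h0⟩
  obtain ⟨a, b, h, -⟩ := key (n + 1)
  exact absurd h.le (by omega)

theorem exists_isAdaptedSystem_add_two [CharP F 2] (hN : IsOrthNilpotent N)
    (halt : ∀ x, hypForm F n x (N x) = 0) {a b : ℕ → Fin n ⊕ Fin n → F} {m : ℕ} (hm : Even m)
    (h : IsAdaptedSystem N flipParity 0 a b m) {z : Fin n ⊕ Fin n → F}
    (hz : z ∈ hypOrthogonal a b m) (hz0 : N z ≠ 0) :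
    ∃ a' b', IsAdaptedSystem N flipParity 0 a' b' (m + 2) := by
  obtain ⟨w, hw, hzw⟩ := h.exists_mem_hypOrthogonal_map_eq_one hN hz hz0
  have hq : ∀ x, quadForm F n (N x) = 0 := fun x => by rw [hN.quad, halt]
  have hNK : ∀ {x}, x ∈ hypOrthogonal a b m → N x ∈ hypOrthogonal a b m :=
    fun hx => h.map_mem_hypOrthogonal hN hx
  obtain ⟨s, hs, t, ht, hqs, hqt, hst, hfst⟩ : ∃ s ∈ hypOrthogonal a b m,
      ∃ t ∈ hypOrthogonal a b m, quadForm F n s = 0 ∧ quadForm F n t = 0 ∧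
        hypForm F n s t = 0 ∧ hypForm F n s (N t) = 1 := by
    have hwz : hypForm F n w (N z) = 1 := by rw [hN.form_comm, hzw]
    set z' := z + quadForm F n z • N w with hz'
    set w' := w + quadForm F n w • N z with hw'
    have hqz : quadForm F n z' = 0 := by
      rw [hz', quadForm_add, quadForm_smul, hq, map_smul, hzw]
      simp [CharTwo.add_self_eq_zero]
    have hqw : quadForm F n w' = 0 := by
      rw [hw', quadForm_add, quadForm_smul, hq, map_smul, hwz]
      simp [CharTwo.add_self_eq_zero]
    have hNw : N w' = N w := by rw [hw', map_add, map_smul, hN.sq, smul_zero, add_zero]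
    have hzw' : hypForm F n z' (N w') = 1 := by
      rw [hNw, hz', map_add, map_smul, LinearMap.add_apply, LinearMap.smul_apply,
        hN.form_map_left, smul_zero, add_zero, hzw]
    refine ⟨z', add_mem hz (Submodule.smul_mem _ _ (hNK hw)),
      w' + hypForm F n z' w' • N w', ?_, hqz, ?_, ?_, ?_⟩
    · have : w' ∈ hypOrthogonal a b m := add_mem hw (Submodule.smul_mem _ _ (hNK hz))
      exact add_mem this (Submodule.smul_mem _ _ (hNK this))
    · rw [quadForm_add, quadForm_smul, hq, map_smul, halt, hqw]
      simp
    · rw [map_add, map_smul, hzw', smul_eq_mul, mul_one,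
        CharTwo.add_self_eq_zero]
    · rw [map_add N, map_smul N, hN.sq, smul_zero, add_zero, hzw']
  have hfts : hypForm F n t (N s) = 1 := by rw [hN.form_comm, hfst]
  have h1 := h.exists_succ hs (hNK ht) hqs (hq t) hfst
  have h2 := h1.exists_succ (s := t) (t := N s)
    (mem_hypOrthogonal_update.2 ⟨ht, by rw [hypForm_comm, hst], halt t⟩)
    (mem_hypOrthogonal_update.2 ⟨hNK hs, by rw [hypForm_comm, halt], hN.form_map_left _ _⟩)
    hqt (hq s) hfts
  refine ⟨_, _, h2, fun i hi => flipParity_lt (hm.add even_two) hi,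
    fun i _ => flipParity_flipParity i, fun i hi => ?_⟩
  rw [zero_smul, add_zero]
  have hcases : i < m ∨ i = m ∨ i = m + 1 := by omega
  rcases hcases with hi | rfl | rfl
  · have hi' := flipParity_lt hm hi
    have := h.map_left i hi
    rw [zero_smul, add_zero] at this
    rw [Function.update_of_ne (by omega), Function.update_of_ne hi.ne,
      Function.update_of_ne (by omega), Function.update_of_ne hi'.ne, this]
  · rw [flipParity_of_even hm, Function.update_of_ne (by omega), Function.update_self,
      Function.update_self]
  · rw [flipParity_succ_of_even hm, Function.update_self, Function.update_of_ne (by omega),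
      Function.update_self]

theorem exists_isAdaptedSystem_of_eq_zero [CharP F 2] (hN : IsOrthNilpotent N)
    (halt : ∀ x, hypForm F n x (N x) = 0) :
    ∃ (a b : ℕ → Fin n ⊕ Fin n → F) (r : ℕ), Even r ∧ IsAdaptedSystem N flipParity 0 a b r ∧
      ∀ x ∈ hypOrthogonal a b r, N x = 0 := by
  by_contra! hne
  have key : ∀ m : ℕ, ∃ a b, IsAdaptedSystem N flipParity 0 a b (2 * m) := by
    intro m
    induction m with
    | zero =>
      refine ⟨0, 0, ⟨⟨?_, ?_, ?_, ?_, ?_⟩, ?_, ?_, ?_⟩⟩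
      all_goals exact fun i hi => absurd hi (Nat.not_lt_zero i)
    | succ m ih =>
      obtain ⟨a, b, h⟩ := ih
      obtain ⟨z, hz, hz0⟩ := hne a b _ (even_two_mul m) h
      exact hN.exists_isAdaptedSystem_add_two halt (even_two_mul m) h hz hz0
  obtain ⟨a, b, h⟩ := key (n + 1)
  exact absurd h.le (by omega)

end IsOrthNilpotent

end AdaptedSystems

section GramSchmidt

/-- An involution of `{0, …, r - 1}` which moves every element by at most one. -/
structure IsPairing (σ : ℕ → ℕ) (r : ℕ) : Prop where
  lt : ∀ i < r, σ i < r
  invol : ∀ i < r, σ (σ i) = i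
  le_of_lt : ∀ i < r, ∀ j < i, j ≤ σ i

namespace IsPairing

variable {σ : ℕ → ℕ} {r : ℕ}

theorem eq_or_eq (h : IsPairing σ r) {i : ℕ} (hi : i < r) :
    σ i = i ∨ σ i = i + 1 ∨ σ i + 1 = i := by
  rcases lt_trichotomy (σ i) i with h' | h' | h'
  · have := h.le_of_lt i hi (i - 1) (by omega)
    omega
  · exact Or.inl h'
  · have := h.le_of_lt (σ i) (h.lt i hi) (σ i - 1) (by omega)
    rw [h.invol i hi] at this
    omega

theorem apply_lt_min (h : IsPairing σ r) {i j : ℕ} (hi : i < r) (hj : j < min i (σ i)) :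
    σ j < min i (σ i) := by
  have h1 := h.eq_or_eq hi
  have h2 := h.eq_or_eq (i := j) (by omega)
  have h3 := h.invol i hi
  have h4 := h.invol j (by omega)
  by_contra hcon
  have : σ j = i ∨ σ j = σ i := by omega
  rcases this with h5 | h5
  · rw [h5] at h4
    omega
  · rw [h5, h3] at h4
    omega

theorem apply_lt_max (h : IsPairing σ r) {i j : ℕ} (hi : i < r) (hj : j < max i (σ i) + 1) :
    σ j < max i (σ i) + 1 := by
  have h0 := h.lt i hi
  have h1 := h.eq_or_eq hi
  have h2 := h.eq_or_eq (i := j) (by omega)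
  have h3 := h.invol i hi
  have h4 := h.invol j (by omega)
  by_contra hcon
  have : j = i ∨ j = σ i := by omega
  rcases this with rfl | rfl <;> omega

end IsPairing

variable {F V : Type*} [Field F] [AddCommGroup V] [Module F V]

/-- The Gram matrix of the first `m` terms of a sequence. -/
def gramMatrix (f : LinearMap.BilinForm F V) (e : ℕ → V) (m : ℕ) : Matrix (Fin m) (Fin m) F :=
  Matrix.of fun i j => f (e i) (e j)

theorem exists_gram_sum_eq {f : LinearMap.BilinForm F V} {e : ℕ → V} {m : ℕ}
    (h : (gramMatrix f e m).det ≠ 0) (y : V) :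
    ∃ c : ℕ → F, (∀ l, m ≤ l → c l = 0) ∧
      ∀ j < m, f (e j) (∑ l ∈ Finset.range m, c l • e l) = f (e j) y := by
  set w := (gramMatrix f e m)⁻¹ *ᵥ fun j => f (e j) y with hw
  have hw' : gramMatrix f e m *ᵥ w = fun j : Fin m => f (e j) y := by
    rw [hw, Matrix.mulVec_mulVec, Matrix.mul_nonsing_inv _ (isUnit_iff_ne_zero.2 h),
      Matrix.one_mulVec]
  refine ⟨fun l => if hl : l < m then w ⟨l, hl⟩ else 0, fun l hl => dif_neg (by omega),
    fun j hj => ?_⟩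
  rw [← congrFun hw' ⟨j, hj⟩, map_sum, Finset.sum_range]
  refine Finset.sum_congr rfl fun l _ => ?_
  simp [gramMatrix, mul_comm]

theorem eq_zero_of_gram {f : LinearMap.BilinForm F V} {e : ℕ → V} {m : ℕ}
    (h : (gramMatrix f e m).det ≠ 0) {c : ℕ → F}
    (hc : ∀ j < m, f (e j) (∑ l ∈ Finset.range m, c l • e l) = 0) : ∀ l < m, c l = 0 := by
  have : gramMatrix f e m *ᵥ (fun l => c l) = 0 := by
    ext j
    rw [Pi.zero_apply, ← hc j j.2, map_sum, Finset.sum_range, Matrix.mulVec, dotProduct]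
    refine Finset.sum_congr rfl fun l _ => ?_
    simp [gramMatrix, mul_comm]
  intro l hl
  exact congrFun (Matrix.eq_zero_of_mulVec_eq_zero h this) ⟨l, hl⟩

theorem sum_range_eq_of_le {c : ℕ → F} {e : ℕ → V} {m l : ℕ} (h : m ≤ l)
    (hc : ∀ i, m ≤ i → c i = 0) :
    ∑ i ∈ Finset.range l, c i • e i = ∑ i ∈ Finset.range m, c i • e i := by
  symm
  apply Finset.sum_subset (Finset.range_subset_range.2 h)
  intro i _ hi
  rw [hc i (by simpa using hi), zero_smul]

/-- Gram–Schmidt orthogonalization with respect to a symmetric form of prescribed position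
relative to a flag. -/
theorem exists_gram_pairing {f : LinearMap.BilinForm F V} (hf : ∀ x y, f x y = f y x)
    {σ : ℕ → ℕ} {r n : ℕ} (hσ : IsPairing σ r) (hrn : r ≤ n)
    (hdiag : (∀ i < r, σ i = i) ∨ ∀ x, f x x = 0) {e : ℕ → V}
    (hdet : ∀ m ≤ r, (∀ i < m, σ i < m) → (gramMatrix f e m).det ≠ 0) :
    ∃ c : ℕ → ℕ → F, (∀ i, c i i = 1) ∧ (∀ i l, i < l → c i l = 0) ∧
      (∀ i < r, ∀ j < n, j ≠ σ i →
        f (∑ l ∈ Finset.range n, c i l • e l) (∑ l ∈ Finset.range n, c j l • e l) = 0) ∧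
      ∀ i < r, f (∑ l ∈ Finset.range n, c i l • e l)
        (∑ l ∈ Finset.range n, c (σ i) l • e l) ≠ 0 := by
  set μ : ℕ → ℕ := fun i => if i < r then min i (σ i) else r with hμ
  have hμr : ∀ i, μ i ≤ r := fun i => by simp only [hμ]; split_ifs <;> omega
  have hμi : ∀ i, μ i ≤ i := fun i => by simp only [hμ]; split_ifs <;> omega
  have hμT : ∀ i, ∀ j < μ i, σ j < μ i := fun i j hj => by
    simp only [hμ] at hj ⊢
    split_ifs at hj ⊢ with hi
    · exact hσ.apply_lt_min hi hj
    · exact hσ.lt j hj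
  choose p hp hpe using fun i => exists_gram_sum_eq (hdet (μ i) (hμr i) (hμT i)) (e i)
  set c : ℕ → ℕ → F := fun i l => (if l = i then 1 else 0) - p i l with hc
  have hcii : ∀ i, c i i = 1 := fun i => by simp [hc, hp i i (hμi i)]
  have hcil : ∀ i l, i < l → c i l = 0 := fun i l hil => by
    simp [hc, hp i l ((hμi i).trans hil.le), hil.ne']
  set a : ℕ → V := fun i => e i - ∑ l ∈ Finset.range (μ i), p i l • e l with ha
  have hac : ∀ N, ∀ i < N, ∑ l ∈ Finset.range N, c i l • e l = a i := fun N i hi => by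
    simp only [hc, sub_smul, Finset.sum_sub_distrib, ha]
    rw [sum_range_eq_of_le ((hμi i).trans hi.le) (hp i)]
    simp [ite_smul, hi]
  have hea : ∀ j i, j < μ i → f (e j) (a i) = 0 := fun j i hj => by
    simp only [ha]
    rw [map_sub, hpe i j hj, sub_self]
  have haa : ∀ i j, i < μ j → f (a i) (a j) = 0 := fun i j hij => by
    rw [← hac (i + 1) i (Nat.lt_succ_self i), map_sum, LinearMap.sum_apply]
    refine Finset.sum_eq_zero fun l hl => ?_
    rw [map_smul, LinearMap.smul_apply, hea l j (by have := Finset.mem_range.1 hl; omega),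
      smul_zero]
  have horth : ∀ i < r, ∀ j, j ≠ σ i → f (a i) (a j) = 0 := by
    intro i hi j hj
    by_cases h1 : i < μ j
    · exact haa i j h1
    by_cases h2 : j < μ i
    · rw [hf, haa j i h2]
    have hjr : j < r := by
      by_contra hjr
      simp only [hμ, if_neg hjr] at h1
      omega
    simp only [hμ, if_pos hi, if_pos hjr] at h1 h2
    have h3 := hσ.eq_or_eq hi
    have h4 := hσ.eq_or_eq hjr
    have h5 := hσ.invol j hjr
    have hij : j = i := by
      by_contra hne
      rcases Nat.lt_or_gt_of_ne hne with h6 | h6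
      · omega
      · have : σ j = i := by omega
        rw [this] at h5
        omega
    subst hij
    rcases hdiag with h | h
    · exact absurd (h j hi).symm hj
    · exact h _
  refine ⟨c, hcii, hcil, fun i hi j hj hji => ?_, fun i hi h0 => ?_⟩
  · rw [hac n i (by omega), hac n j hj, horth i hi j hji]
  · have hlt := hσ.lt i hi
    rw [hac n i (by omega), hac n (σ i) (by omega)] at h0
    have hall : ∀ j, f (a i) (a j) = 0 := fun j => by
      by_cases hj : j = σ i
      · rw [hj, h0]
      · exact horth i hi j hj
    have hall' : ∀ j, f (a i) (e j) = 0 := fun j => by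
      induction j using Nat.strong_induction_on with
      | _ j ih =>
        have : e j = a j + ∑ l ∈ Finset.range (μ j), p j l • e l := by simp [ha]
        rw [this, map_add, hall j, zero_add, map_sum]
        refine Finset.sum_eq_zero fun l hl => ?_
        rw [map_smul, ih l ((Finset.mem_range.1 hl).trans_le (hμi j)), smul_zero]
    have hdet' := hdet (max i (σ i) + 1) (by omega) fun j hj => hσ.apply_lt_max hi hj
    have := eq_zero_of_gram hdet' (c := c i)
      (fun j _ => by rw [hac _ i (by omega), hf, hall' j]) i (by omega)
    rw [hcii] at this
    exact one_ne_zero this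

/-- A normalized version of `exists_gram_pairing` over an algebraically closed field. -/
theorem exists_gram_pairing_eq_one [IsAlgClosed F] {f : LinearMap.BilinForm F V}
    (hf : ∀ x y, f x y = f y x)
    {σ : ℕ → ℕ} {r n : ℕ} (hσ : IsPairing σ r) (hrn : r ≤ n)
    (hdiag : (∀ i < r, σ i = i) ∨ ∀ x, f x x = 0) {e : ℕ → V}
    (hdet : ∀ m ≤ r, (∀ i < m, σ i < m) → (gramMatrix f e m).det ≠ 0) :
    ∃ c : ℕ → ℕ → F, (∀ i, c i i ≠ 0) ∧ (∀ i l, i < l → c i l = 0) ∧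
      ∀ i < r, ∀ j < n, f (∑ l ∈ Finset.range n, c i l • e l)
        (∑ l ∈ Finset.range n, c j l • e l) = if j = σ i then 1 else 0 := by
  obtain ⟨c, hc1, hc0, horth, hne⟩ := exists_gram_pairing hf hσ hrn hdiag hdet
  set a : ℕ → V := fun i => ∑ l ∈ Finset.range n, c i l • e l with ha
  choose s hs using fun x : F => IsAlgClosed.exists_pow_nat_eq x two_pos
  set d : ℕ → F := fun i => if i < r then (s (f (a i) (a (σ i))))⁻¹ else 1 with hd
  have hs0 : ∀ i < r, s (f (a i) (a (σ i))) ≠ 0 := fun i hi h0 => by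
    refine hne i hi ?_
    have := hs (f (a i) (a (σ i)))
    rw [h0, zero_pow two_ne_zero] at this
    exact this.symm
  have hd0 : ∀ i, d i ≠ 0 := fun i => by
    simp only [hd]
    split_ifs with hi
    · exact inv_ne_zero (hs0 i hi)
    · exact one_ne_zero
  refine ⟨fun i l => d i * c i l, fun i => by simp [hc1, hd0], fun i l h => by simp [hc0 i l h],
    fun i hi j hj => ?_⟩
  simp only [mul_smul, ← Finset.smul_sum]
  simp only [map_smul, LinearMap.smul_apply, smul_eq_mul]
  split_ifs with hji
  · subst hji
    have h1 : f (a (σ i)) (a (σ (σ i))) = f (a i) (a (σ i)) := by rw [hσ.invol i hi, hf]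
    have h2 : d (σ i) = d i := by simp only [hd, if_pos hi, if_pos (hσ.lt i hi), h1]
    rw [h2]
    simp only [hd, if_pos hi]
    change _ * (_ * f (a i) (a (σ i))) = 1
    conv_lhs => rw [← hs (f (a i) (a (σ i)))]
    rw [hs]
    have := hs0 i hi
    field_simp
    exact (hs _).symm
  · rw [horth i hi j hj hji, mul_zero, mul_zero]

end GramSchmidt

section NormalForms

variable {F : Type*} [Field F] {n : ℕ}

theorem hypForm_eq_sub (x y : Fin n ⊕ Fin n → F) :
    hypForm F n x y = quadForm F n (x + y) - quadForm F n x - quadForm F n y := by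
  rw [quadForm_add]
  ring

theorem hypForm_mulVec {A : Matrix (Fin n ⊕ Fin n) (Fin n ⊕ Fin n) F}
    (hA : ∀ x, quadForm F n (A *ᵥ x) = quadForm F n x) (x y : Fin n ⊕ Fin n → F) :
    hypForm F n (A *ᵥ x) (A *ᵥ y) = hypForm F n x y := by
  rw [hypForm_eq_sub, ← Matrix.mulVec_add, hA, hA, hA, ← hypForm_eq_sub]

theorem exists_mem_evenOrthGroup {A : Matrix (Fin n ⊕ Fin n) (Fin n ⊕ Fin n) F}
    (hA : ∀ x, quadForm F n (A *ᵥ x) = quadForm F n x) :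
    ∃ g ∈ evenOrthGroup F n, (g : Matrix (Fin n ⊕ Fin n) (Fin n ⊕ Fin n) F) = A := by
  have hdet : A.det ≠ 0 := fun h0 => by
    obtain ⟨x, hx, hx0⟩ := Matrix.exists_mulVec_eq_zero_iff.2 h0
    refine hx (eq_zero_of_hypForm fun y => ?_)
    rw [← hypForm_mulVec hA, hx0, map_zero, LinearMap.zero_apply]
  exact ⟨Matrix.GeneralLinearGroup.mkOfDetNeZero A hdet, hA, rfl⟩

/-- The standard basis vectors of the first Lagrangian subspace, extended by zero. -/
def stdLeft (F : Type*) [Field F] (n : ℕ) (i : ℕ) : Fin n ⊕ Fin n → F :=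
  if h : i < n then Pi.single (.inl ⟨i, h⟩) 1 else 0

/-- The standard basis vectors of the second Lagrangian subspace, extended by zero. -/
def stdRight (F : Type*) [Field F] (n : ℕ) (i : ℕ) : Fin n ⊕ Fin n → F :=
  if h : i < n then Pi.single (.inr ⟨i, h⟩) 1 else 0

theorem stdLeft_val (i : Fin n) : stdLeft F n i = Pi.single (.inl i) 1 := dif_pos i.2

theorem stdRight_val (i : Fin n) : stdRight F n i = Pi.single (.inr i) 1 := dif_pos i.2

/-- The matrix whose columns are the terms of the sequences `a` and `b`. -/
def columnMatrix (a b : ℕ → Fin n ⊕ Fin n → F) : Matrix (Fin n ⊕ Fin n) (Fin n ⊕ Fin n) F :=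
  Matrix.of fun p q => Sum.elim (fun i : Fin n => a i p) (fun i : Fin n => b i p) q

theorem columnMatrix_mulVec (a b : ℕ → Fin n ⊕ Fin n → F) (x : Fin n ⊕ Fin n → F) :
    columnMatrix a b *ᵥ x = ∑ i : Fin n, (x (.inl i) • a i + x (.inr i) • b i) := by
  ext p
  simp [columnMatrix, Matrix.mulVec, dotProduct, Fintype.sum_sum_type, Finset.sum_apply,
    Finset.sum_add_distrib, mul_comm]

theorem columnMatrix_mulVec_stdLeft (a b : ℕ → Fin n ⊕ Fin n → F) {i : ℕ} (hi : i < n) :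
    columnMatrix a b *ᵥ stdLeft F n i = a i := by
  rw [stdLeft, dif_pos hi, Matrix.mulVec_single_one]
  rfl

theorem columnMatrix_mulVec_stdRight (a b : ℕ → Fin n ⊕ Fin n → F) {i : ℕ} (hi : i < n) :
    columnMatrix a b *ᵥ stdRight F n i = b i := by
  rw [stdRight, dif_pos hi, Matrix.mulVec_single_one]
  rfl

theorem IsHyperbolicSystem.quadForm_sum {a b : ℕ → Fin n ⊕ Fin n → F} {l : ℕ}
    (h : IsHyperbolicSystem a b l) (c d : ℕ → F) {m : ℕ} (hm : m ≤ l) :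
    quadForm F n (∑ i ∈ Finset.range m, (c i • a i + d i • b i)) =
      ∑ i ∈ Finset.range m, c i * d i := by
  induction m with
  | zero => simp [quadForm]
  | succ m ih =>
    have h0 : hypForm F n (∑ i ∈ Finset.range m, (c i • a i + d i • b i))
        (c m • a m + d m • b m) = 0 := by
      rw [map_sum, LinearMap.sum_apply]
      refine Finset.sum_eq_zero fun i hi => ?_
      rw [Finset.mem_range] at hi
      have him : i ≠ m := hi.ne
      simp [h.left_left i (by omega) m (by omega), h.right_right i (by omega) m (by omega),
        h.left_right i (by omega) m (by omega), h.right_left (i := i) (j := m) (by omega)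
        (by omega), him]
    rw [Finset.sum_range_succ, Finset.sum_range_succ, quadForm_add, ih (by omega), h0, add_zero,
      quadForm_add, quadForm_smul, quadForm_smul, h.quad_left m (by omega),
      h.quad_right m (by omega), map_smul, map_smul, LinearMap.smul_apply,
      h.left_right m (by omega) m (by omega)]
    simp [mul_comm]

theorem IsHyperbolicSystem.exists_mem_evenOrthGroup {a b : ℕ → Fin n ⊕ Fin n → F}
    (h : IsHyperbolicSystem a b n) : ∃ g ∈ evenOrthGroup F n,
      (g : Matrix (Fin n ⊕ Fin n) (Fin n ⊕ Fin n) F) = columnMatrix a b := by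
  refine _root_.exists_mem_evenOrthGroup fun x => ?_
  have := h.quadForm_sum (fun i => if hi : i < n then x (.inl ⟨i, hi⟩) else 0)
    (fun i => if hi : i < n then x (.inr ⟨i, hi⟩) else 0) le_rfl
  rw [Finset.sum_range, Finset.sum_range] at this
  simpa [columnMatrix_mulVec, quadForm] using this

/-- The linear map `u - 1` attached to an invertible matrix `u`. -/
def nilPart (u : GL (Fin n ⊕ Fin n) F) : (Fin n ⊕ Fin n → F) →ₗ[F] (Fin n ⊕ Fin n → F) :=
  Matrix.mulVecLin ((u : Matrix (Fin n ⊕ Fin n) (Fin n ⊕ Fin n) F) - 1)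

theorem nilPart_apply (u : GL (Fin n ⊕ Fin n) F) (x : Fin n ⊕ Fin n → F) :
    nilPart u x = (u : Matrix (Fin n ⊕ Fin n) (Fin n ⊕ Fin n) F) *ᵥ x - x := by
  rw [nilPart, Matrix.mulVecLin_apply, Matrix.sub_mulVec, Matrix.one_mulVec]

theorem nilPart_conj (g u : GL (Fin n ⊕ Fin n) F) (x : Fin n ⊕ Fin n → F) :
    nilPart (g * u * g⁻¹) x = (g : Matrix (Fin n ⊕ Fin n) (Fin n ⊕ Fin n) F) *ᵥ
      nilPart u
        (((g⁻¹ : GL (Fin n ⊕ Fin n) F) : Matrix (Fin n ⊕ Fin n) (Fin n ⊕ Fin n) F) *ᵥ x) := by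
  rw [nilPart_apply, nilPart_apply, Matrix.mulVec_sub]
  simp only [Matrix.mulVec_mulVec, ← Units.val_mul, mul_inv_cancel, Units.val_one,
    Matrix.one_mulVec, mul_assoc]

theorem finrank_range_nilPart_conj_le (g u : GL (Fin n ⊕ Fin n) F) :
    Module.finrank F (LinearMap.range (nilPart (g * u * g⁻¹))) ≤
      Module.finrank F (LinearMap.range (nilPart u)) := by
  have : (((g * u * g⁻¹ : GL (Fin n ⊕ Fin n) F) :
      Matrix (Fin n ⊕ Fin n) (Fin n ⊕ Fin n) F) - 1).rank ≤
      ((u : Matrix (Fin n ⊕ Fin n) (Fin n ⊕ Fin n) F) - 1).rank := by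
    have h : (((g * u * g⁻¹ : GL (Fin n ⊕ Fin n) F) :
        Matrix (Fin n ⊕ Fin n) (Fin n ⊕ Fin n) F) - 1) = g.1 * (u.1 - 1) * (g⁻¹).1 := by
      rw [mul_sub, sub_mul, mul_one, ← Units.val_mul, ← Units.val_mul, ← Units.val_mul,
        mul_inv_cancel, Units.val_one]
    rw [h]
    exact (Matrix.rank_mul_le_left _ _).trans (Matrix.rank_mul_le_right _ _)
  exact this

theorem isOrthNilpotent_nilPart [CharP F 2] {u : GL (Fin n ⊕ Fin n) F}
    (hu : u ∈ evenOrthGroup F n) (hu2 : u * u = 1) : IsOrthNilpotent (nilPart u) := by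
  have huu : ∀ x : Fin n ⊕ Fin n → F, u.1 *ᵥ (u.1 *ᵥ x) = x := fun x => by
    rw [Matrix.mulVec_mulVec, ← Units.val_mul, hu2, Units.val_one, Matrix.one_mulVec]
  refine ⟨fun x => ?_, fun x y => ?_, fun x => ?_⟩
  · rw [nilPart_apply, nilPart_apply, Matrix.mulVec_sub, huu,
      sub_eq_add_neg (x - u.1 *ᵥ x), neg_sub]
    exact funext fun _ => CharTwo.add_self_eq_zero _
  · rw [nilPart_apply, nilPart_apply, map_sub, map_sub, LinearMap.sub_apply,
      ← hypForm_mulVec hu (u.1 *ᵥ x) y, huu]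
  · rw [nilPart_apply, map_sub, hypForm_self, sub_zero,
      show u.1 *ᵥ x - x = u.1 *ᵥ x + x from funext fun _ => CharTwo.sub_eq_add _ _, quadForm_add,
      mem_evenOrthGroup_iff.1 hu, CharTwo.add_self_eq_zero, zero_add, hypForm_comm]

/-- The standard form of the nilpotent part of an involution relative to two sequences. -/
structure IsNormalPair (N : (Fin n ⊕ Fin n → F) →ₗ[F] (Fin n ⊕ Fin n → F)) (σ : ℕ → ℕ) (ε : F)
    (r : ℕ) (a b : ℕ → Fin n ⊕ Fin n → F) : Prop where
  map_left : ∀ i < n, N (a i) = if i < r then b (σ i) + ε • a (σ i) else 0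
  map_right : ∀ i < n, N (b i) = -(ε • N (a i))

variable {σ : ℕ → ℕ} {ε : F} {r : ℕ} {a b : ℕ → Fin n ⊕ Fin n → F}

theorem IsNormalPair.conj {u g : GL (Fin n ⊕ Fin n) F} (h : IsNormalPair (nilPart u) σ ε r a b)
    (hg : (g : Matrix (Fin n ⊕ Fin n) (Fin n ⊕ Fin n) F) = columnMatrix a b)
    (hσ : ∀ i < r, σ i < r) (hr : r ≤ n) :
    IsNormalPair (nilPart (g⁻¹ * u * g)) σ ε r (stdLeft F n) (stdRight F n) := by
  have hl : ∀ i < n, g.1 *ᵥ stdLeft F n i = a i := fun i hi => by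
    rw [hg, columnMatrix_mulVec_stdLeft a b hi]
  have hr' : ∀ i < n, g.1 *ᵥ stdRight F n i = b i := fun i hi => by
    rw [hg, columnMatrix_mulVec_stdRight a b hi]
  have hinv : ∀ x : Fin n ⊕ Fin n → F, (g⁻¹).1 *ᵥ (g.1 *ᵥ x) = x := fun x => by
    rw [Matrix.mulVec_mulVec, ← Units.val_mul, inv_mul_cancel, Units.val_one, Matrix.one_mulVec]
  have hN : ∀ x, nilPart (g⁻¹ * u * g) x = (g⁻¹).1 *ᵥ nilPart u (g.1 *ᵥ x) := fun x => by
    simpa using nilPart_conj g⁻¹ u x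
  constructor
  · intro i hi
    rw [hN, hl i hi, h.map_left i hi]
    split_ifs with hir
    · have := hσ i hir
      rw [← hl (σ i) (by omega), ← hr' (σ i) (by omega), ← Matrix.mulVec_smul,
        ← Matrix.mulVec_add, hinv]
    · exact Matrix.mulVec_zero _
  · intro i hi
    rw [hN, hN, hl i hi, hr' i hi, h.map_right i hi, Matrix.mulVec_neg, Matrix.mulVec_smul]

theorem IsNormalPair.eq_of_std {u v : GL (Fin n ⊕ Fin n) F}
    (hu : IsNormalPair (nilPart u) σ ε r (stdLeft F n) (stdRight F n))
    (hv : IsNormalPair (nilPart v) σ ε r (stdLeft F n) (stdRight F n)) : u = v := by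
  have h : nilPart u = nilPart v := by
    refine LinearMap.pi_ext' fun p => LinearMap.ext_ring ?_
    simp only [LinearMap.comp_apply, LinearMap.single_apply]
    rcases p with i | i
    · rw [← stdLeft_val, hu.map_left i i.2, hv.map_left i i.2]
    · rw [← stdRight_val, hu.map_right i i.2, hv.map_right i i.2, hu.map_left i i.2,
        hv.map_left i i.2]
  refine Units.ext ?_
  exact sub_left_injective (Matrix.toLin'.injective h)

theorem IsNormalPair.finrank_range_le {N : (Fin n ⊕ Fin n → F) →ₗ[F] (Fin n ⊕ Fin n → F)}
    (h : IsNormalPair N σ ε r (stdLeft F n) (stdRight F n)) :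
    Module.finrank F (LinearMap.range N) ≤ r := by
  set S := Submodule.span F
    (Set.range fun i : Fin r => stdRight F n (σ i) + ε • stdLeft F n (σ i)) with hS
  have hl : ∀ i < n, N (stdLeft F n i) ∈ S := fun i hi => by
    rw [h.map_left i hi]
    split_ifs with hir
    · exact Submodule.subset_span ⟨⟨i, hir⟩, rfl⟩
    · exact zero_mem _
  have hle : LinearMap.range N ≤ S := by
    rintro _ ⟨x, rfl⟩
    rw [LinearMap.pi_apply_eq_sum_univ]
    refine Submodule.sum_mem _ fun p _ => Submodule.smul_mem _ _ ?_
    rcases p with i | i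
    · have := hl i i.2
      rw [stdLeft_val] at this
      convert this using 2
      ext q
      simp [Pi.single_apply, eq_comm]
    · have := S.neg_mem (S.smul_mem ε (hl i i.2))
      rw [← h.map_right i i.2, stdRight_val] at this
      convert this using 2
      ext q
      simp [Pi.single_apply, eq_comm]
  refine (Submodule.finrank_mono hle).trans ((finrank_range_le_card _).trans ?_)
  rw [Fintype.card_fin]

/-- The form `⟨x, N y⟩` attached to a linear map `N`. -/
def formOf (N : (Fin n ⊕ Fin n → F) →ₗ[F] (Fin n ⊕ Fin n → F)) :
    LinearMap.BilinForm F (Fin n ⊕ Fin n → F) :=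
  (hypForm F n).compl₂ N

theorem formOf_apply (N : (Fin n ⊕ Fin n → F) →ₗ[F] (Fin n ⊕ Fin n → F))
    (x y : Fin n ⊕ Fin n → F) : formOf N x y = hypForm F n x (N y) := rfl

theorem formOf_stdLeft (N : (Fin n ⊕ Fin n → F) →ₗ[F] (Fin n ⊕ Fin n → F)) (i j : Fin n) :
    formOf N (stdLeft F n i) (stdLeft F n j) = N (Pi.single (.inl j) 1) (.inr i) := by
  rw [formOf_apply, stdLeft_val, stdLeft_val, hypForm_apply]
  simp [Pi.single_apply]

theorem IsNormalPair.det_gramMatrix_ne_zero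
    {N : (Fin n ⊕ Fin n → F) →ₗ[F] (Fin n ⊕ Fin n → F)}
    (h : IsNormalPair N σ ε r (stdLeft F n) (stdRight F n)) (hσ : IsPairing σ r) (hr : r ≤ n)
    {m : ℕ} (hm : m ≤ r) (hσm : ∀ i < m, σ i < m) :
    (gramMatrix (formOf N) (stdLeft F n) m).det ≠ 0 := by
  have hG : ∀ i j : Fin m, gramMatrix (formOf N) (stdLeft F n) m i j =
      if (i : ℕ) = σ j then 1 else 0 := by
    intro i j
    have hi := i.2
    have hj := j.2
    have hσj := hσm j hj
    rw [gramMatrix, Matrix.of_apply, formOf_apply, h.map_left j (by omega), if_pos (by omega),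
      stdLeft, stdLeft, stdRight, dif_pos (by omega), dif_pos (by omega), dif_pos (by omega),
      hypForm_apply]
    simp [Pi.single_apply]
    exact if_congr eq_comm rfl rfl
  have hsq : gramMatrix (formOf N) (stdLeft F n) m * gramMatrix (formOf N) (stdLeft F n) m = 1 := by
    ext i j
    have hj := j.2
    rw [Matrix.mul_apply, Finset.sum_eq_single ⟨σ j, hσm j j.2⟩]
    · rw [hG, hG, Matrix.one_apply]
      simp [hσ.invol j (by omega), Fin.ext_iff]
    · intro k _ hk
      rw [hG k, if_neg (fun h => hk (Fin.ext h)), mul_zero]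
    · simp
  intro h0
  have := congrArg Matrix.det hsq
  simp [h0] at this

end NormalForms

section Transitivity

variable {F : Type*} [Field F] {n : ℕ} {N : (Fin n ⊕ Fin n → F) →ₗ[F] (Fin n ⊕ Fin n → F)}
  {σ : ℕ → ℕ} {ε : F} {r : ℕ}

/-- The two possible types of the nilpotent part of an involution: the attached form is either
diagonalizable or alternating. -/
def IsNormalType (N : (Fin n ⊕ Fin n → F) →ₗ[F] (Fin n ⊕ Fin n → F)) (σ : ℕ → ℕ) (ε : F)
    (r : ℕ) : Prop :=
  ((∀ i < r, σ i = i) ∧ ε = 1) ∨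
    ((∀ i < r, σ i ≠ i) ∧ ε = 0 ∧ ∀ x, hypForm F n x (N x) = 0)

theorem IsAdaptedSystem.exists_isNormalPair [IsAlgClosed F] [CharP F 2] (hN : IsOrthNilpotent N)
    {a b : ℕ → Fin n ⊕ Fin n → F} (h : IsAdaptedSystem N σ ε a b r)
    (hK : ∀ x ∈ hypOrthogonal a b r, N x = 0) :
    ∃ a' b', IsHyperbolicSystem a' b' n ∧ IsNormalPair N σ ε r a' b' := by
  obtain ⟨a', b', h', ha, hb⟩ := h.exists_extension
  have hrn := h.le
  have hzero : ∀ i < n, r ≤ i → N (a' i) = 0 ∧ N (b' i) = 0 := by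
    intro i hi hri
    refine ⟨hK _ fun j hj => ?_, hK _ fun j hj => ?_⟩
    · rw [← ha j hj, ← hb j hj, h'.left_left i hi j (by omega), h'.left_right i hi j (by omega),
        if_neg (by omega)]
      exact ⟨rfl, rfl⟩
    · rw [← ha j hj, ← hb j hj, h'.right_right i hi j (by omega),
        h'.right_left hi (by omega : j < n), if_neg (by omega)]
      exact ⟨rfl, rfl⟩
  refine ⟨a', b', h', fun i hi => ?_, fun i hi => ?_⟩
  · split_ifs with hir
    · rw [ha i hir, h.map_left i hir, ha _ (h.lt i hir), hb _ (h.lt i hir)]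
    · exact (hzero i hi (by omega)).1
  · by_cases hir : i < r
    · rw [ha i hir, hb i hir, h.map_right hN hir]
    · rw [(hzero i hi (by omega)).1, (hzero i hi (by omega)).2, smul_zero, neg_zero]

theorem IsOrthNilpotent.exists_isNormalPair [IsAlgClosed F] [CharP F 2]
    (hN : IsOrthNilpotent N) : ∃ (σ : ℕ → ℕ) (ε : F) (r : ℕ) (a b : ℕ → Fin n ⊕ Fin n → F),
      IsPairing σ r ∧ r ≤ n ∧ IsNormalType N σ ε r ∧ IsHyperbolicSystem a b n ∧
        IsNormalPair N σ ε r a b := by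
  by_cases hx : ∃ x, hypForm F n x (N x) ≠ 0
  · obtain ⟨x, hx⟩ := hx
    obtain ⟨a, b, r, h, hK⟩ := hN.exists_isAdaptedSystem_of_ne hx
    obtain ⟨a', b', h', hn⟩ := h.exists_isNormalPair hN hK
    exact ⟨id, 1, r, a', b', ⟨h.lt, h.invol, fun i _ j hj => hj.le⟩, h.le,
      Or.inl ⟨fun _ _ => rfl, rfl⟩, h', hn⟩
  · push Not at hx
    obtain ⟨a, b, r, -, h, hK⟩ := hN.exists_isAdaptedSystem_of_eq_zero hx
    obtain ⟨a', b', h', hn⟩ := h.exists_isNormalPair hN hK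
    exact ⟨flipParity, 0, r, a', b', ⟨h.lt, h.invol, fun i _ j hj => le_flipParity hj⟩, h.le,
      Or.inr ⟨fun i _ => flipParity_ne i, rfl, hx⟩, h', hn⟩

/-- A totally singular sequence admitting dual vectors extends to a hyperbolic system with a
prescribed beginning. -/
theorem exists_isHyperbolicSystem_of_dual [CharP F 2] {a b : ℕ → Fin n ⊕ Fin n → F}
    (hq : ∀ i < n, quadForm F n (a i) = 0)
    (ha : ∀ i < n, ∀ j < n, hypForm F n (a i) (a j) = 0)
    (hdual : ∀ m < n, ∃ t, ∀ i < n, hypForm F n (a i) t = if i = m then 1 else 0)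
    (hr : r ≤ n) (hbq : ∀ i < r, quadForm F n (b i) = 0)
    (hbb : ∀ i < r, ∀ j < r, hypForm F n (b i) (b j) = 0)
    (hab : ∀ i < n, ∀ j < r, hypForm F n (a i) (b j) = if i = j then 1 else 0) :
    ∃ b' : ℕ → Fin n ⊕ Fin n → F, IsHyperbolicSystem a b' n ∧ ∀ i < r, b' i = b i := by
  suffices key : ∀ m, r ≤ m → m ≤ n → ∃ b' : ℕ → Fin n ⊕ Fin n → F, (∀ i < r, b' i = b i) ∧
      (∀ i < m, quadForm F n (b' i) = 0) ∧ (∀ i < m, ∀ j < m, hypForm F n (b' i) (b' j) = 0) ∧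
      ∀ i < n, ∀ j < m, hypForm F n (a i) (b' j) = if i = j then 1 else 0 by
    obtain ⟨b', h1, h2, h3, h4⟩ := key n hr le_rfl
    exact ⟨b', ⟨hq, h2, ha, h3, h4⟩, h1⟩
  intro m hm
  induction m, hm using Nat.le_induction with
  | base => exact fun _ => ⟨b, fun _ _ => rfl, hbq, hbb, hab⟩
  | succ m hm ih =>
    intro hmn
    obtain ⟨b', h1, h2, h3, h4⟩ := ih (by omega)
    obtain ⟨t, ht⟩ := hdual m (by omega)
    obtain ⟨t', ht', htb⟩ : ∃ t', (∀ i < n, hypForm F n (a i) t' = if i = m then 1 else 0) ∧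
        ∀ j < m, hypForm F n (b' j) t' = 0 := by
      refine ⟨t - ∑ l ∈ Finset.range m, hypForm F n (b' l) t • a l, fun i hi => ?_,
        fun j hj => ?_⟩
      · rw [map_sub, ht i hi, map_sum, Finset.sum_eq_zero, sub_zero]
        intro l hl
        rw [map_smul, ha i hi l (by have := Finset.mem_range.1 hl; omega), smul_zero]
      · rw [map_sub, map_sum, Finset.sum_eq_single j, map_smul, hypForm_comm (b' j) (a j),
          h4 j (by omega) j hj, if_pos rfl, smul_eq_mul, mul_one, sub_self]
        · intro l hl hlj
          rw [map_smul, hypForm_comm _ (a l), h4 l (by have := Finset.mem_range.1 hl; omega) j hj,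
            if_neg hlj, smul_zero]
        · simp [hj]
    obtain ⟨s, hs, hsb, hsq⟩ : ∃ s, (∀ i < n, hypForm F n (a i) s = if i = m then 1 else 0) ∧
        (∀ j < m, hypForm F n (b' j) s = 0) ∧ quadForm F n s = 0 := by
      refine ⟨t' + quadForm F n t' • a m, fun i hi => ?_, fun j hj => ?_, ?_⟩
      · rw [map_add, map_smul, ha i hi m (by omega), smul_zero, add_zero, ht' i hi]
      · rw [map_add, map_smul, htb j hj, hypForm_comm, h4 m (by omega) j hj, if_neg (by omega),
          smul_zero, add_zero]
      · rw [quadForm_add, quadForm_smul, hq m (by omega), map_smul, hypForm_comm,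
          ht' m (by omega), if_pos rfl, mul_zero, add_zero, smul_eq_mul, mul_one,
          CharTwo.add_self_eq_zero]
    have hlt : ∀ i < m, Function.update b' m s i = b' i :=
      fun i hi => Function.update_of_ne hi.ne _ _
    refine ⟨Function.update b' m s, fun i hi => by rw [hlt i (by omega), h1 i hi], ?_, ?_, ?_⟩
    · intro i hi
      rcases Nat.lt_succ_iff_lt_or_eq.1 hi with hi | rfl
      · rw [hlt i hi, h2 i hi]
      · rw [Function.update_self, hsq]
    · intro i hi j hj
      rcases Nat.lt_succ_iff_lt_or_eq.1 hi with hi | rfl <;>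
        rcases Nat.lt_succ_iff_lt_or_eq.1 hj with hj | rfl
      · rw [hlt i hi, hlt j hj, h3 i hi j hj]
      · rw [hlt i hi, Function.update_self, hsb i hi]
      · rw [hlt j hj, Function.update_self, hypForm_comm, hsb j hj]
      · rw [Function.update_self, hypForm_self]
    · intro i hi j hj
      rcases Nat.lt_succ_iff_lt_or_eq.1 hj with hj | rfl
      · rw [hlt j hj, h4 i hi j hj]
      · rw [Function.update_self, hs i hi]

/-- If the form attached to `N` has a nondegenerate pairing on `r` vectors, where `r` bounds
the rank of `N`, then the kernel of `N` is the orthogonal of the images of these vectors. -/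
theorem map_eq_zero_of_pairing (hσ : IsPairing σ r)
    (hrank : Module.finrank F (LinearMap.range N) ≤ r) {a : ℕ → Fin n ⊕ Fin n → F}
    (ha : ∀ i < r, ∀ j < r, hypForm F n (a i) (N (a j)) = if j = σ i then 1 else 0)
    {x : Fin n ⊕ Fin n → F} (hx : ∀ i < r, hypForm F n (a i) (N x) = 0) : N x = 0 := by
  let φ : LinearMap.range N →ₗ[F] (Fin r → F) :=
    (LinearMap.pi fun i : Fin r => hypForm F n (a i)).comp (LinearMap.range N).subtype
  have hφ : Function.Surjective φ := by
    intro c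
    have hc : ∀ y, φ ⟨N y, y, rfl⟩ = fun i : Fin r => hypForm F n (a i) (N y) := fun _ => rfl
    refine ⟨⟨N (∑ j : Fin r, c j • a (σ j)), _, rfl⟩, ?_⟩
    rw [hc]
    ext i
    rw [map_sum, map_sum, Finset.sum_eq_single i]
    · rw [map_smul, map_smul, ha i i.2 _ (hσ.lt i i.2), if_pos rfl, smul_eq_mul, mul_one]
    · intro j _ hji
      rw [map_smul, map_smul, ha i i.2 _ (hσ.lt j j.2), if_neg, smul_zero]
      intro h
      have := congrArg σ h
      rw [hσ.invol i i.2, hσ.invol j j.2] at this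
      exact hji (Fin.ext this)
    · simp
  have hrank' : Module.finrank F (LinearMap.range N) = Module.finrank F (Fin r → F) := by
    refine le_antisymm (by simpa using hrank) (LinearMap.finrank_le_finrank_of_surjective hφ)
  have hinj := (LinearMap.injective_iff_surjective_of_finrank_eq_finrank hrank').2 hφ
  have h0 : φ ⟨N x, x, rfl⟩ = 0 := funext fun i => hx i i.2
  exact congrArg Subtype.val (hinj (h0.trans (map_zero φ).symm))

theorem exists_isHyperbolicSystem_isNormalPair [CharP F 2] (hN : IsOrthNilpotent N)
    (hσ : IsPairing σ r) (hr : r ≤ n) (hT : IsNormalType N σ ε r)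
    (hrank : Module.finrank F (LinearMap.range N) ≤ r) {a : ℕ → Fin n ⊕ Fin n → F}
    (hq : ∀ i < n, quadForm F n (a i) = 0)
    (ha : ∀ i < n, ∀ j < n, hypForm F n (a i) (a j) = 0)
    (hdual : ∀ m < n, ∃ t, ∀ i < n, hypForm F n (a i) t = if i = m then 1 else 0)
    (hpair : ∀ i < r, ∀ j < n, hypForm F n (a i) (N (a j)) = if j = σ i then 1 else 0) :
    ∃ b, IsHyperbolicSystem a b n ∧ IsNormalPair N σ ε r a b := by
  have hker : ∀ x, (∀ i < r, hypForm F n (a i) (N x) = 0) → N x = 0 := fun x hx =>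
    map_eq_zero_of_pairing hσ hrank (fun i hi j hj => hpair i hi j (by omega)) hx
  have hσn : ∀ i < r, σ i < n := fun i hi => (hσ.lt i hi).trans_le hr
  have hNa : ∀ i < n, r ≤ i → N (a i) = 0 := fun i hi hri =>
    hker _ fun j hj => by rw [hpair j hj i hi, if_neg (by have := hσ.lt j hj; omega)]
  have hab : ∀ i < n, ∀ j < r, hypForm F n (a i) (N (a (σ j)) - ε • a j) =
      if i = j then 1 else 0 := by
    intro i hi j hj
    rw [map_sub, map_smul, ha i hi j (by omega), smul_zero, sub_zero]
    by_cases hir : i < r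
    · rw [hpair i hir _ (hσn j hj)]
      refine if_congr ⟨fun h => ?_, fun h => h ▸ rfl⟩ rfl rfl
      have := congrArg σ h
      rw [hσ.invol i hir, hσ.invol j hj] at this
      exact this.symm
    · rw [hN.form_comm, hNa i hi (by omega), map_zero, if_neg (by omega)]
  obtain ⟨b, hb, hbr⟩ := exists_isHyperbolicSystem_of_dual (r := r)
    (b := fun i => N (a (σ i)) - ε • a i) hq ha hdual hr
    (by
      intro i hi
      rw [sub_eq_add_neg, ← neg_smul, quadForm_add, quadForm_smul, hq i (by omega), hN.quad,
        hpair (σ i) (hσ.lt i hi) (σ i) (hσn i hi), map_smul, hN.symm, hN.form_comm,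
        hN.form_comm, hN.form_comm, hpair i hi _ (hσn i hi), hσ.invol i hi, if_pos rfl]
      rcases hT with ⟨h1, h2⟩ | ⟨h1, h2, -⟩
      · rw [if_pos (h1 i hi), h2]
        simp
      · rw [if_neg (h1 i hi), h2]
        simp)
    (by
      intro i hi j hj
      rw [map_sub, map_sub, LinearMap.sub_apply, LinearMap.sub_apply, hN.form_map_left, map_smul,
        map_smul, map_smul, LinearMap.smul_apply, LinearMap.smul_apply, hypForm_comm (N _) (a j),
        ha i (by omega) j (by omega), hpair i hi _ (hσn j hj), hpair j hj _ (hσn i hi)]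
      simp only [eq_comm (a := σ j)]
      simp [CharTwo.sub_eq_add])
    hab
  refine ⟨b, hb, fun i hi => ?_, fun i hi => ?_⟩
  · split_ifs with hir
    · rw [hbr _ (hσ.lt i hir), hσ.invol i hir, sub_add_cancel]
    · exact hNa i hi (by omega)
  · by_cases hir : i < r
    · rw [hbr i hir, map_sub, map_smul, hN.sq, zero_sub]
    · rw [hNa i hi (by omega), smul_zero, neg_zero]
      refine hker _ fun j hj => ?_
      have h1 : N (a j) = b (σ j) + ε • a (σ j) := by
        rw [hbr _ (hσ.lt j hj), hσ.invol j hj, sub_add_cancel]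
      have := hσ.lt j hj
      rw [hN.form_comm, h1, map_add, map_smul, hb.right_right i hi _ (by omega),
        hb.right_left hi (by omega), if_neg (by omega), smul_zero, add_zero]

theorem exists_mem_stdTriangular_isNormalPair [IsAlgClosed F] [CharP F 2] (hN : IsOrthNilpotent N)
    (hσ : IsPairing σ r) (hr : r ≤ n) (hT : IsNormalType N σ ε r)
    (hrank : Module.finrank F (LinearMap.range N) ≤ r)
    (hdet : ∀ m ≤ r, (∀ i < m, σ i < m) →
      (gramMatrix (formOf N) (stdLeft F n) m).det ≠ 0) :
    ∃ (a b : ℕ → Fin n ⊕ Fin n → F), IsNormalPair N σ ε r a b ∧ ∃ g ∈ stdTriangular F n,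
      (g : Matrix (Fin n ⊕ Fin n) (Fin n ⊕ Fin n) F) = columnMatrix a b := by
  obtain ⟨c, hc1, hc0, hpair⟩ := exists_gram_pairing_eq_one (f := formOf N) (n := n)
    (fun x y => hN.form_comm x y) hσ hr (hT.imp (fun h => h.1) fun h => h.2.2) hdet
  set a : ℕ → Fin n ⊕ Fin n → F := fun i => Sum.elim (fun l => c i l) 0 with ha
  have hac : ∀ i, ∑ l ∈ Finset.range n, c i l • stdLeft F n l = a i := by
    intro i
    rw [Finset.sum_range]
    ext (l | l) <;> simp [stdLeft_val, Finset.sum_apply, ha, Pi.single_apply]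
  simp only [hac, formOf_apply] at hpair
  let R : Matrix (Fin n) (Fin n) F := Matrix.of fun i l => c i l
  have hR : R.det ≠ 0 := by
    rw [Matrix.det_of_isLowerTriangular R fun i j hij => hc0 i j hij, Finset.prod_ne_zero_iff]
    exact fun i _ => hc1 i
  obtain ⟨b, hb, hn⟩ := exists_isHyperbolicSystem_isNormalPair hN hσ hr hT hrank (a := a)
    (fun i _ => by rw [ha, quadForm_sumElim, dotProduct_zero])
    (fun i _ j _ => by simp only [ha]; rw [hypForm_sumElim]; simp)
    (by
      intro m hm
      refine ⟨Sum.elim 0 (R⁻¹ *ᵥ Pi.single ⟨m, hm⟩ 1), fun i hi => ?_⟩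
      have h1 : R *ᵥ (R⁻¹ *ᵥ Pi.single ⟨m, hm⟩ 1) = Pi.single ⟨m, hm⟩ 1 := by
        rw [Matrix.mulVec_mulVec, Matrix.mul_nonsing_inv _ (isUnit_iff_ne_zero.2 hR),
          Matrix.one_mulVec]
      have h2 := congrFun h1 ⟨i, hi⟩
      simp only [ha]
      rw [hypForm_sumElim, zero_dotProduct, add_zero]
      refine h2.trans ?_
      simp [Pi.single_apply])
    hpair
  obtain ⟨g, hg, hgab⟩ := hb.exists_mem_evenOrthGroup
  refine ⟨a, b, hn, g, mem_stdTriangular_of_toBlocks hg ?_ ?_, hgab⟩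
  · rw [hgab]
    rfl
  · rw [hgab]
    exact fun i j hij => hc0 j i hij

end Transitivity

section Openness

variable {F : Type*} [Field F] {n : ℕ}

theorem det_mem_glRegular {m p : Type*} [DecidableEq m] [Fintype m] [DecidableEq p] [Fintype p]
    {G : GL m F → Matrix p p F} (h : ∀ i j, (fun v => G v i j) ∈ glRegular F m) :
    (fun v => (G v).det) ∈ glRegular F m := by
  have : (fun v => (G v).det) =
      ∑ τ : Equiv.Perm p, Equiv.Perm.sign τ • ∏ i, fun v => G v (τ i) i := by
    ext v
    simp [Matrix.det_apply, Finset.sum_apply, Finset.prod_apply]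
  rw [this]
  refine sum_mem fun τ _ => ?_
  have hmem : (∏ i, fun v => G v (τ i) i) ∈ glRegular F m := prod_mem fun i _ => h _ _
  rcases Int.units_eq_one_or (Equiv.Perm.sign τ) with hτ | hτ
  · rwa [hτ, one_smul]
  · rw [hτ, Units.neg_smul, one_smul]
    exact neg_mem hmem

/-- The set of matrices `v` such that the form attached to `v - 1` is in general position with
respect to the standard flag, for the given pairing. -/
def pairingOpen (F : Type*) [Field F] (n : ℕ) (σ : ℕ → ℕ) (r : ℕ) :
    Set (GL (Fin n ⊕ Fin n) F) :=
  {v | ∀ m ≤ r, (∀ i < m, σ i < m) →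
    (gramMatrix (formOf (nilPart v)) (stdLeft F n) m).det ≠ 0}

theorem isOpen_pairingOpen (σ : ℕ → ℕ) {r : ℕ} (hr : r ≤ n) : IsOpen (pairingOpen F n σ r) := by
  have : pairingOpen F n σ r = ⋂ m ∈ {m | m ≤ r ∧ ∀ i < m, σ i < m},
      {v | (gramMatrix (formOf (nilPart v)) (stdLeft F n) m).det ≠ 0} := by
    ext v
    simp [pairingOpen]
  rw [this]
  refine Set.Finite.isOpen_biInter ((Set.finite_Iic r).subset fun m hm => hm.1) fun m hm => ?_
  refine isOpen_ne_zero_of_mem_glRegular (det_mem_glRegular fun i j => ?_)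
  have hi : (i : ℕ) < n := i.2.trans_le (hm.1.trans hr)
  have hj : (j : ℕ) < n := j.2.trans_le (hm.1.trans hr)
  have hentry : (fun v : GL (Fin n ⊕ Fin n) F =>
      gramMatrix (formOf (nilPart v)) (stdLeft F n) m i j) =
      fun v : GL (Fin n ⊕ Fin n) F => v.1 (.inr ⟨i, hi⟩) (.inl ⟨j, hj⟩) := by
    ext v
    have := formOf_stdLeft (nilPart v) ⟨i, hi⟩ ⟨j, hj⟩
    rw [nilPart_apply, Matrix.mulVec_single_one] at this
    simpa [gramMatrix] using this
  rw [hentry]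
  exact entry_mem_glRegular _ _

theorem IsNormalType.conj {σ : ℕ → ℕ} {ε : F} {r : ℕ} {u g : GL (Fin n ⊕ Fin n) F}
    (h : IsNormalType (nilPart u) σ ε r) (hg : g ∈ evenOrthGroup F n) :
    IsNormalType (nilPart (g * u * g⁻¹)) σ ε r := by
  refine h.imp_right fun ⟨h1, h2, h3⟩ => ⟨h1, h2, fun x => ?_⟩
  rw [nilPart_conj, ← hypForm_mulVec (inv_mem hg), Matrix.mulVec_mulVec _ _ g.1,
    ← Units.val_mul, inv_mul_cancel, Units.val_one, Matrix.one_mulVec, h3]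

theorem isSphericalClass_of_mul_self_eq_one [IsAlgClosed F] [CharP F 2] (u : evenSOGroup F n)
    (hu : u * u = 1) : IsSphericalClass (evenSOGroup F n) (conjClass u) := by
  set w : GL (Fin n ⊕ Fin n) F := u.1 with hw
  have hwO : w ∈ evenOrthGroup F n := evenSOGroup_le u.2
  have hww : w * w = 1 := congrArg Subtype.val hu
  obtain ⟨σ, ε, r, a, b, hσ, hr, hT, hab, hn⟩ :=
    (isOrthNilpotent_nilPart hwO hww).exists_isNormalPair
  obtain ⟨g, hg, hgab⟩ := hab.exists_mem_evenOrthGroup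
  have hstd := hn.conj hgab hσ.lt hr
  have hrank : Module.finrank F (LinearMap.range (nilPart w)) ≤ r := by
    have h := (finrank_range_nilPart_conj_le g (g⁻¹ * w * g)).trans hstd.finrank_range_le
    rwa [show g * (g⁻¹ * w * g) * g⁻¹ = w by group] at h
  refine isSphericalClass_of_isOpen u (inv_mem hg) (isOpen_pairingOpen σ hr) ?_ ?_
  · rw [inv_inv]
    exact fun m hm hσm => hstd.det_gramMatrix_ne_zero hσ hr hm hσm
  · intro v hv hU
    have hvO : v * w * v⁻¹ ∈ evenOrthGroup F n := mul_mem (mul_mem hv hwO) (inv_mem hv)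
    have hv2 : v * w * v⁻¹ * (v * w * v⁻¹) = 1 := by
      rw [show v * w * v⁻¹ * (v * w * v⁻¹) = v * (w * w) * v⁻¹ by group, hww]
      group
    obtain ⟨a', b', hn', s, hs, hsab⟩ := exists_mem_stdTriangular_isNormalPair
      (isOrthNilpotent_nilPart hvO hv2) hσ hr (hT.conj hv)
      ((finrank_range_nilPart_conj_le v w).trans hrank) hU
    refine ⟨s, hs, ?_⟩
    rw [inv_inv, hstd.eq_of_std (hn'.conj hsab hσ.lt hr), hw]
    group

end Openness

/-- Let `k` be an algebraically closed field of characteristic 2 and let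
`G = SO(2n, k)` with `n ≥ 4`. Then the conjugacy class of every involution of `G`
(every element `u ≠ 1` with `u² = 1`) is spherical. -/
theorem spherical_of_involution_special_orthogonal_char_two
    (k : Type*) [Field k] [IsAlgClosed k] (hchar : ringChar k = 2)
    (n : ℕ) (hn : 4 ≤ n)
    (u : evenSOGroup k n) (hu : u ≠ 1) (hu2 : u ^ 2 = 1) :
    IsSphericalClass (evenSOGroup k n) (conjClass u) := by
  have : CharP k 2 := ringChar.of_eq hchar
  exact isSphericalClass_of_mul_self_eq_one u (by rw [← sq, hu2])
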